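/- arXiv:2408.08128 — 3 statements merged into one kernel-verified Lean document; each statement's English description precedes it below -/
import Mathlib

section
/- The following two statements are equivalent: (i) every cubic, bipartite, 2-factor Hamiltonian graph is constructible from K_{3,3} and the Heawood graph via the star product; (ii) every cubic, 2-factor Hamiltonian brace is isomorphic to K_{3,3} or to the Heawood graph. -/
open SimpleGraph

/-- A graph is cubic if every vertex has degree 3. -/
def IsCubic {V : Type*} (G : SimpleGraph V) : Prop :=
  ∀ v : V, (G.neighborSet v).ncard = 3

/-- A 2-factor of `G` is a 2-regular spanning subgraph of `G`. -/
def IsTwoFactor {V : Type*} (G : SimpleGraph V) (H : G.Subgraph) : Prop :=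
  H.IsSpanning ∧ ∀ v : V, (H.neighborSet v).ncard = 2

/-- A graph is 2-factor Hamiltonian if every 2-factor of it is a Hamiltonian cycle,
i.e. a connected 2-regular spanning subgraph. -/
def IsTwoFactorHamiltonian {V : Type*} (G : SimpleGraph V) : Prop :=
  ∀ H : G.Subgraph, IsTwoFactor G H → H.Connected

/-- A brace is a connected bipartite graph on at least four vertices in which every
matching of size at most two is contained in a perfect matching. -/
def IsBrace {V : Type*} (G : SimpleGraph V) : Prop :=
  G.Connected ∧ G.Colorable 2 ∧ 4 ≤ Nat.card V ∧
    ∀ M : G.Subgraph, M.IsMatching → M.edgeSet.ncard ≤ 2 →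
      ∃ P : G.Subgraph, M ≤ P ∧ P.IsPerfectMatching

/-- The Heawood graph, as the point-line incidence graph of the Fano plane:
points and lines are indexed by `Fin 7`, and point `p` lies on line `l` iff
`p + l ∈ {0, 1, 3}` (mod 7), `{0,1,3}` being a planar difference set mod 7. -/
def heawoodGraph : SimpleGraph (Fin 7 ⊕ Fin 7) :=
  SimpleGraph.fromRel fun a b => ∃ p l : Fin 7,
    a = Sum.inl p ∧ b = Sum.inr l ∧ (p + l = 0 ∨ p + l = 1 ∨ p + l = 3)

/-- A cycle (given as a closed walk) alternates between edges of the subgraph `M`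
and edges not in `M`; the wrap-around pair is included by appending the first edge. -/
def IsAlternatingCycle {V : Type*} {G : SimpleGraph V} (M : G.Subgraph) {v : V}
    (p : G.Walk v v) : Prop :=
  p.IsCycle ∧
    List.Chain' (fun e f => e ∈ M.edgeSet ↔ f ∉ M.edgeSet) (p.edges ++ p.edges.take 1)

/-- `σ` is a Pfaffian orientation of `G`: it orients every edge (exactly one direction),
and for every perfect matching `M` and every `M`-alternating cycle, the number of
its edges oriented in agreement with the direction of traversal is odd. -/
def IsPfaffianOrientation {V : Type*} (G : SimpleGraph V) (σ : V → V → Bool) : Prop :=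
  (∀ u v : V, G.Adj u v → σ u v = !σ v u) ∧
  ∀ M : G.Subgraph, M.IsPerfectMatching →
    ∀ (v : V) (p : G.Walk v v), IsAlternatingCycle M p →
      Odd (p.darts.filter fun d => σ d.toProd.1 d.toProd.2).length

/-- A graph with a perfect matching is Pfaffian if it admits a Pfaffian orientation. -/
def IsPfaffian {V : Type*} (G : SimpleGraph V) : Prop :=
  (∃ M : G.Subgraph, M.IsPerfectMatching) ∧ ∃ σ : V → V → Bool, IsPfaffianOrientation G σ

/-- The cut `∂X`: the set of edges of `G` with exactly one endpoint in `X`. -/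
def edgeCut {V : Type*} (G : SimpleGraph V) (X : Set V) : Set (Sym2 V) :=
  {e | e ∈ G.edgeSet ∧ ∃ u w : V, e = s(u, w) ∧ u ∈ X ∧ w ∉ X}

/-- A cut `∂X` is tight if every perfect matching contains exactly one of its edges. -/
def IsTightCut {V : Type*} (G : SimpleGraph V) (X : Set V) : Prop :=
  ∀ M : G.Subgraph, M.IsPerfectMatching → (edgeCut G X ∩ M.edgeSet).ncard = 1

/-- A cut `∂X` is trivial if `|X| = 1` or `|V(G) \ X| = 1`. -/
def IsTrivialCut {V : Type*} (X : Set V) : Prop :=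
  X.ncard = 1 ∨ (Xᶜ : Set V).ncard = 1

/-- The tight cut contraction keeping `X`: contract `V(G) \ X` into a single vertex
(`Sum.inr ()`), deleting loops and parallel edges. -/
def contractOutside {V : Type*} (G : SimpleGraph V) (X : Set V) :
    SimpleGraph (↥X ⊕ Unit) :=
  SimpleGraph.fromRel fun a b =>
    (∃ u v : X, a = Sum.inl u ∧ b = Sum.inl v ∧ G.Adj u v) ∨
    (∃ (u : X) (w : V), w ∉ X ∧ a = Sum.inl u ∧ b = Sum.inr () ∧ G.Adj u w)

/-- A graph is `k`-connected if it has more than `k` vertices and deleting any set of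
fewer than `k` vertices leaves it connected. -/
def IsKConnected {V : Type*} (k : ℕ) (G : SimpleGraph V) : Prop :=
  k < Nat.card V ∧ ∀ S : Set V, S.ncard < k → (G.induce (Sᶜ : Set V)).Connected

/-- A graph is matching covered if it is connected, has an edge, and every edge
lies in a perfect matching. -/
def IsMatchingCovered {V : Type*} (G : SimpleGraph V) : Prop :=
  G.Connected ∧ G.edgeSet.Nonempty ∧
    ∀ e ∈ G.edgeSet, ∃ M : G.Subgraph, M.IsPerfectMatching ∧ e ∈ M.edgeSet

/-- A graph is bridgeless if no edge is a bridge. -/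
def Bridgeless {V : Type*} (G : SimpleGraph V) : Prop :=
  ∀ e : Sym2 V, ¬ G.IsBridge e

/-- `(A, B)` is a bipartition of `G` into the two colour classes `A` and `B`. -/
def IsBipartition {V : Type*} (G : SimpleGraph V) (A B : Set V) : Prop :=
  A ∪ B = Set.univ ∧ Disjoint A B ∧
    ∀ u v : V, G.Adj u v → ((u ∈ A ∧ v ∈ B) ∨ (u ∈ B ∧ v ∈ A))

/-- `G` is the star product `(G1,v1)*(G2,v2)`, witnessed by the embeddings `f` of
`G1 - v1` and `g` of `G2 - v2` into `G`, and the bijection `m` matching the three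
neighbours of `v1` to the three neighbours of `v2`: `v1` and `v2` have degree 3,
the images of `f` and `g` partition the vertices of `G`, and the edges of `G` are
exactly the edges of `G1 - v1`, the edges of `G2 - v2`, and the three matching edges
`f x — g (m x)` for `x` a neighbour of `v1`. -/
def IsStarProductWitness {V V1 V2 : Type*} (G : SimpleGraph V)
    (G1 : SimpleGraph V1) (v1 : V1) (G2 : SimpleGraph V2) (v2 : V2)
    (f : V1 → V) (g : V2 → V) (m : V1 → V2) : Prop :=
  (G1.neighborSet v1).ncard = 3 ∧ (G2.neighborSet v2).ncard = 3 ∧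
  Set.InjOn f {x | x ≠ v1} ∧ Set.InjOn g {y | y ≠ v2} ∧
  (∀ x y, x ≠ v1 → y ≠ v2 → f x ≠ g y) ∧
  (∀ v : V, (∃ x, x ≠ v1 ∧ f x = v) ∨ (∃ y, y ≠ v2 ∧ g y = v)) ∧
  Set.BijOn m (G1.neighborSet v1) (G2.neighborSet v2) ∧
  (∀ a b : V, G.Adj a b ↔
    ((∃ x y, x ≠ v1 ∧ y ≠ v1 ∧ G1.Adj x y ∧ a = f x ∧ b = f y) ∨
     (∃ x y, x ≠ v2 ∧ y ≠ v2 ∧ G2.Adj x y ∧ a = g x ∧ b = g y) ∨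
     (∃ x, G1.Adj v1 x ∧ ((a = f x ∧ b = g (m x)) ∨ (b = f x ∧ a = g (m x))))))

/-- `G` is a star product `(G1,v1)*(G2,v2)`. -/
def IsStarProduct {V V1 V2 : Type*} (G : SimpleGraph V)
    (G1 : SimpleGraph V1) (v1 : V1) (G2 : SimpleGraph V2) (v2 : V2) : Prop :=
  ∃ (f : V1 → V) (g : V2 → V) (m : V1 → V2),
    IsStarProductWitness G G1 v1 G2 v2 f g m

/-- The principal 3-edge cut of a star product: the three added matching edges. -/
def principalCut {V V1 V2 : Type*} (G1 : SimpleGraph V1) (v1 : V1)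
    (f : V1 → V) (g : V2 → V) (m : V1 → V2) : Set (Sym2 V) :=
  {e | ∃ x, G1.Adj v1 x ∧ e = s(f x, g (m x))}

/-- The smallest class of (finite) graphs that contains `K_{3,3}` and the Heawood graph
(up to isomorphism) and is closed under taking star products. -/
inductive Constructible : {V : Type} → SimpleGraph V → Prop where
  | k33 {V : Type} (G : SimpleGraph V)
      (h : Nonempty (G ≃g completeBipartiteGraph (Fin 3) (Fin 3))) : Constructible G
  | heawood {V : Type} (G : SimpleGraph V)
      (h : Nonempty (G ≃g heawoodGraph)) : Constructible G
  | star {V V1 V2 : Type} (G : SimpleGraph V)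
      (G1 : SimpleGraph V1) (v1 : V1) (G2 : SimpleGraph V2) (v2 : V2)
      (h1 : Constructible G1) (h2 : Constructible G2)
      (h : IsStarProduct G G1 v1 G2 v2) : Constructible G

/-- Every vertex of `H` has degree `k`. -/
def IsRegularGraph {V : Type*} (k : ℕ) (H : SimpleGraph V) : Prop :=
  ∀ v : V, (H.neighborSet v).ncard = k

/-- The edges of `H` leaving `X`, directed outwards, whose inner end has colour `b`. -/
def crossing {V : Type*} (H : SimpleGraph V) (c : V → Bool) (b : Bool) (X : Set V) :
    Set (V × V) :=
  {p | c p.1 = b ∧ p.1 ∈ X ∧ p.2 ∉ X ∧ H.Adj p.1 p.2}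

/-- The edges of `H` leaving `X`, directed outwards. -/
def outEdges {V : Type*} (H : SimpleGraph V) (X : Set V) : Set (V × V) :=
  {p | p.1 ∈ X ∧ p.2 ∉ X ∧ H.Adj p.1 p.2}

section Counting

variable {V : Type} [Fintype V]

lemma ncard_darts {H : SimpleGraph V} {k : ℕ} (hH : IsRegularGraph k H) (S : Set V) :
    {p : V × V | p.1 ∈ S ∧ H.Adj p.1 p.2}.ncard = k * S.ncard := by
  classical
  rw [← Nat.card_coe_set_eq]
  have e : {p : V × V | p.1 ∈ S ∧ H.Adj p.1 p.2} ≃ Σ v : S, H.neighborSet v :=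
    { toFun := fun p => ⟨⟨p.1.1, p.2.1⟩, ⟨p.1.2, p.2.2⟩⟩
      invFun := fun q => ⟨(q.1.1, q.2.1), q.1.2, q.2.2⟩
      left_inv := fun _ => rfl
      right_inv := fun _ => rfl }
  rw [Nat.card_congr e, Nat.card_sigma]
  have : ∀ v : S, Nat.card (H.neighborSet v) = k := fun v => by
    rw [Nat.card_coe_set_eq]; exact hH v
  rw [Finset.sum_congr rfl fun v _ => this v, Finset.sum_const, smul_eq_mul, mul_comm,
    Finset.card_univ, ← Nat.card_eq_fintype_card, Nat.card_coe_set_eq]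

lemma ncard_outEdges (H : SimpleGraph V) (c : V → Bool) (X : Set V) :
    (outEdges H X).ncard = (crossing H c true X).ncard + (crossing H c false X).ncard := by
  rw [← Set.ncard_union_eq _ (Set.toFinite _) (Set.toFinite _)]
  · congr 1
    ext p
    simp only [outEdges, crossing, Set.mem_ofPred_eq, Set.mem_union]
    cases c p.1 <;> simp
  · rw [Set.disjoint_left]
    rintro p ⟨h, -⟩ ⟨h', -⟩
    simp [h] at h'

/-- The imbalance of `X` between the colour classes of a regular bipartite graph is
governed by the edges leaving `X`. -/
lemma crossing_balance {H : SimpleGraph V} {k : ℕ} (hH : IsRegularGraph k H) {c : V → Bool}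
    (hc : ∀ u v, H.Adj u v → c u ≠ c v) (X : Set V) :
    k * {v | v ∈ X ∧ c v = true}.ncard + (crossing H c false X).ncard =
      k * {v | v ∈ X ∧ c v = false}.ncard + (crossing H c true X).ncard := by
  have split : ∀ b : Bool, k * {v | v ∈ X ∧ c v = b}.ncard =
      {p : V × V | c p.1 = b ∧ p.1 ∈ X ∧ p.2 ∈ X ∧ H.Adj p.1 p.2}.ncard +
        (crossing H c b X).ncard := by
    intro b
    rw [← ncard_darts hH, ← Set.ncard_union_eq _ (Set.toFinite _) (Set.toFinite _)]
    · congr 1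
      ext p
      simp only [crossing, Set.mem_ofPred_eq, Set.mem_union]
      tauto
    · rw [Set.disjoint_left]
      rintro p ⟨-, -, h, -⟩ ⟨-, -, h', -⟩
      exact h' h
  have swap : {p : V × V | c p.1 = true ∧ p.1 ∈ X ∧ p.2 ∈ X ∧ H.Adj p.1 p.2}.ncard =
      {p : V × V | c p.1 = false ∧ p.1 ∈ X ∧ p.2 ∈ X ∧ H.Adj p.1 p.2}.ncard := by
    rw [← Set.ncard_image_of_injective _ (Prod.swap_injective (α := V) (β := V))]
    congr 1
    ext ⟨u, v⟩
    simp only [Set.mem_image, Set.mem_ofPred_eq, Prod.exists, Prod.swap_prod_mk, Prod.mk.injEq]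
    constructor
    · rintro ⟨a, b, ⟨h1, h2, h3, h4⟩, rfl, rfl⟩
      have := hc _ _ h4
      refine ⟨?_, h3, h2, h4.symm⟩
      cases h : c b <;> simp_all
    · rintro ⟨h1, h2, h3, h4⟩
      have := hc _ _ h4
      refine ⟨v, u, ⟨?_, h3, h2, h4.symm⟩, rfl, rfl⟩
      cases h : c v <;> simp_all
  rw [split, split, swap]
  omega

lemma card_color_classes {H : SimpleGraph V} {k : ℕ} (hk : 0 < k) (hH : IsRegularGraph k H)
    {c : V → Bool} (hc : ∀ u v, H.Adj u v → c u ≠ c v) :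
    {v | c v = true}.ncard = {v | c v = false}.ncard := by
  have h := crossing_balance hH hc Set.univ
  have h0 : ∀ b, crossing H c b Set.univ = ∅ := by
    intro b; ext p; simp [crossing]
  simpa [h0, hk.ne'] using h

lemma crossing_mono {H K : SimpleGraph V} (h : H ≤ K) (c : V → Bool) (b : Bool) (X : Set V) :
    (crossing H c b X).ncard ≤ (crossing K c b X).ncard :=
  Set.ncard_le_ncard (fun _ hp => ⟨hp.1, hp.2.1, hp.2.2.1, h hp.2.2.2⟩) (Set.toFinite _)

end Counting

section Matching

variable {V : Type}

lemma IsRegularGraph.existsUnique {P : SimpleGraph V} (hP : IsRegularGraph 1 P) (v : V) :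
    ∃! w, P.Adj v w := by
  obtain ⟨w, hw⟩ := Set.ncard_eq_one.1 (hP v)
  refine ⟨w, ?_, fun y hy => ?_⟩
  · exact (P.mem_neighborSet v w).1 (hw ▸ rfl)
  · have : y ∈ P.neighborSet v := hy
    rw [hw] at this; exact this

lemma isRegularGraph_one_of_existsUnique {P : SimpleGraph V} (h : ∀ v, ∃! w, P.Adj v w) :
    IsRegularGraph 1 P := by
  intro v
  obtain ⟨w, hw, hu⟩ := h v
  rw [Set.ncard_eq_one]
  exact ⟨w, Set.ext fun y => ⟨fun hy => hu y hy, fun hy => by rw [hy]; exact hw⟩⟩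

lemma IsRegularGraph.sdiff [Finite V] {G P : SimpleGraph V} {k l : ℕ}
    (hG : IsRegularGraph k G) (hP : IsRegularGraph l P) (h : P ≤ G) :
    IsRegularGraph (k - l) (G \ P) := by
  intro v
  have : (G \ P).neighborSet v = G.neighborSet v \ P.neighborSet v := by
    ext w; simp
  rw [this, Set.ncard_sdiff (show P.neighborSet v ⊆ G.neighborSet v from fun w hw => h hw) (Set.toFinite _), hG v, hP v]

/-- A 2-factor of a cubic graph is the complement of a perfect matching. -/
lemma isTwoFactorHamiltonian_iff [Finite V] {G : SimpleGraph V} (hG : IsCubic G) :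
    IsTwoFactorHamiltonian G ↔
      ∀ P : SimpleGraph V, P ≤ G → IsRegularGraph 1 P → (G \ P).Connected := by
  constructor
  · intro h P hPG hP
    have hc := h (SimpleGraph.toSubgraph (G \ P) sdiff_le)
      ⟨fun v => trivial, fun v => IsRegularGraph.sdiff hG hP hPG v⟩
    rw [Subgraph.connected_iff'] at hc
    have hsp : (SimpleGraph.toSubgraph (G \ P) (sdiff_le : G \ P ≤ G)).IsSpanning :=
      fun v => trivial
    exact (Subgraph.spanningCoeEquivCoeOfSpanning _ hsp).connected_iff.2 hc
  · rintro h H ⟨hs, h2⟩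
    have hle : H.spanningCoe ≤ G := H.spanningCoe_le
    have hreg : IsRegularGraph 2 H.spanningCoe := h2
    have hc := h (G \ H.spanningCoe) sdiff_le (IsRegularGraph.sdiff hG hreg hle)
    rw [sdiff_sdiff_right_self, inf_eq_right.2 hle] at hc
    rw [Subgraph.connected_iff']
    exact (Subgraph.spanningCoeEquivCoeOfSpanning _ hs).connected_iff.1 hc

lemma isRegularGraph_spanningCoe {G : SimpleGraph V} {P : G.Subgraph}
    (hP : P.IsPerfectMatching) : IsRegularGraph 1 P.spanningCoe :=
  isRegularGraph_one_of_existsUnique fun v => Subgraph.isPerfectMatching_iff.1 hP v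

/-- Hall's theorem for a bipartite graph with colour classes of equal size. -/
lemma exists_perfectMatching_of_hall [Fintype V] [DecidableEq V] {G : SimpleGraph V} {c : V → Bool}
    (hc : ∀ u v, G.Adj u v → c u ≠ c v)
    (hcard : {v | c v = true}.ncard = {v | c v = false}.ncard)
    (t : V → Finset V) (ht : ∀ v, ∀ w ∈ t v, c v = true → G.Adj v w)
    (hall : ∀ S : Finset V, (∀ v ∈ S, c v = true) → S.card ≤ (S.biUnion t).card) :
    ∃ P : SimpleGraph V, P ≤ G ∧ IsRegularGraph 1 P ∧
      ∀ v w, c v = true → P.Adj v w → w ∈ t v := by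
  obtain ⟨f, hf, hft⟩ := (Finset.all_card_le_biUnion_card_iff_exists_injective
    (fun v : {v // c v = true} => t v)).1 (by
      intro s
      have := hall (s.map (Function.Embedding.subtype _)) (by simp +contextual)
      rwa [Finset.card_map, Finset.map_eq_image, Finset.image_biUnion] at this)
  have hfadj : ∀ v : {v // c v = true}, G.Adj v (f v) := fun v => ht v _ (hft v) v.2
  have hfc : ∀ v : {v // c v = true}, c (f v) = false := fun v => by
    have := hc _ _ (hfadj v)
    rw [v.2] at this
    simpa using this.symm
  have hsurj : ∀ w, c w = false → ∃ v, f v = w := by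
    let g : {v // c v = true} → {v // c v = false} := fun v => ⟨f v, hfc v⟩
    have hg : Function.Injective g := fun a b h => hf (congrArg Subtype.val h)
    have hb := hg.bijective_of_nat_card_le (by
      have h1 : Nat.card {v // c v = true} = Nat.card {v // c v = false} := hcard
      exact h1.ge)
    intro w hw
    obtain ⟨v, hv⟩ := hb.2 ⟨w, hw⟩
    exact ⟨v, congrArg Subtype.val hv⟩
  let P : SimpleGraph V :=
    { Adj := fun u w => (∃ h : c u = true, f ⟨u, h⟩ = w) ∨ ∃ h : c w = true, f ⟨w, h⟩ = u
      symm := ⟨fun u w h => h.symm⟩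
      loopless := ⟨fun u h => by
        rcases h with ⟨h, h'⟩ | ⟨h, h'⟩ <;> exact (hfadj ⟨u, h⟩).ne h'.symm⟩ }
  refine ⟨P, ?_, isRegularGraph_one_of_existsUnique fun v => ?_, ?_⟩
  · rintro u w (⟨h, rfl⟩ | ⟨h, rfl⟩)
    · exact hfadj ⟨u, h⟩
    · exact (hfadj ⟨w, h⟩).symm
  · cases hv : c v
    · obtain ⟨u, rfl⟩ := hsurj v hv
      refine ⟨u, Or.inr ⟨u.2, rfl⟩, ?_⟩
      rintro y (⟨h, -⟩ | ⟨h, h'⟩)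
      · simp [hv] at h
      · exact congrArg Subtype.val (hf h')
    · refine ⟨f ⟨v, hv⟩, Or.inl ⟨hv, rfl⟩, ?_⟩
      rintro y (⟨h, h'⟩ | ⟨h, rfl⟩)
      · exact h'.symm
      · simp [hfc] at hv
  · rintro v w hv (⟨h, rfl⟩ | ⟨h, rfl⟩)
    · exact hft ⟨v, h⟩
    · simp [hfc] at hv

end Matching

section Brace

variable {V : Type}

lemma exists_bool_coloring {G : SimpleGraph V} (h : G.Colorable 2) :
    ∃ c : V → Bool, ∀ u v, G.Adj u v → c u ≠ c v := by
  obtain ⟨C⟩ := h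
  refine ⟨fun v => C v = 0, fun u v huv h => C.valid huv ?_⟩
  simp only [decide_eq_decide] at h
  omega

/-- In a cubic bipartite graph, either two edges extend to a perfect matching or they both
belong to a cut of size three whose ends on one side all have the same colour. -/
lemma exists_perfectMatching_or_cut [Fintype V] {G : SimpleGraph V} (hG : IsRegularGraph 3 G)
    {c : V → Bool} (hc : ∀ u v, G.Adj u v → c u ≠ c v) {a₁ b₁ a₂ b₂ : V}
    (h₁ : G.Adj a₁ b₁) (h₂ : G.Adj a₂ b₂) (hc₁ : c a₁ = true) (hc₂ : c a₂ = true)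
    (hab : a₁ = a₂ ↔ b₁ = b₂) :
    (∃ P : SimpleGraph V, P ≤ G ∧ IsRegularGraph 1 P ∧ P.Adj a₁ b₁ ∧ P.Adj a₂ b₂) ∨
      ∃ X : Set V, a₁ ∉ X ∧ a₂ ∉ X ∧ b₁ ∈ X ∧ b₂ ∈ X ∧ b₁ ≠ b₂ ∧
        crossing G c true X = ∅ ∧ (crossing G c false X).ncard = 3 := by
  classical
  by_cases hall : ∀ S : Finset V, (∀ v ∈ S, c v = true ∧ v ≠ a₁ ∧ v ≠ a₂) →
      S.card ≤ ((S.biUnion fun v => G.neighborFinset v) \ {b₁, b₂}).card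
  · left
    obtain ⟨P, hP, hP1, ht⟩ := exists_perfectMatching_of_hall hc
      (card_color_classes (by norm_num) hG hc)
      (fun v => if v = a₁ then {b₁} else if v = a₂ then {b₂} else
        G.neighborFinset v \ {b₁, b₂})
      (by
        intro v w hw _
        split_ifs at hw with h h'
        · simp_all
        · simp_all
        · simp only [Finset.mem_sdiff, mem_neighborFinset] at hw
          exact hw.1)
      (by
        intro S hS
        let S' := S.filter fun v => v ≠ a₁ ∧ v ≠ a₂
        let S'' := S.filter fun v => ¬ (v ≠ a₁ ∧ v ≠ a₂)
        let τ : V → V := fun v => if v = a₁ then b₁ else b₂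
        have hcard : S'.card + S''.card = S.card := Finset.card_filter_add_card_filter_not _
        have h' := hall S' (fun v hv => by
          rw [Finset.mem_filter] at hv
          exact ⟨hS v hv.1, hv.2⟩)
        have himg : (S''.image τ).card = S''.card := by
          apply Finset.card_image_of_injOn
          intro x hx y hy hxy
          simp only [S'', Finset.coe_filter, Set.mem_ofPred_eq] at hx hy
          simp only [τ] at hxy
          grind
        have hdis : Disjoint ((S'.biUnion fun v => G.neighborFinset v) \ {b₁, b₂})
            (S''.image τ) := by
          rw [Finset.disjoint_left]
          intro x hx hx'
          simp only [Finset.mem_sdiff, Finset.mem_insert, Finset.mem_singleton, not_or] at hx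
          obtain ⟨y, -, rfl⟩ := Finset.mem_image.1 hx'
          simp only [τ] at hx
          grind
        calc S.card ≤ (((S'.biUnion fun v => G.neighborFinset v) \ {b₁, b₂}) ∪
              S''.image τ).card := by
              rw [Finset.card_union_of_disjoint hdis]; omega
          _ ≤ _ := by
            apply Finset.card_le_card
            intro x hx
            rw [Finset.mem_biUnion]
            rcases Finset.mem_union.1 hx with hx | hx
            · simp only [Finset.mem_sdiff, Finset.mem_biUnion] at hx
              obtain ⟨⟨v, hv, hvx⟩, hx⟩ := hx
              rw [Finset.mem_filter] at hv
              refine ⟨v, hv.1, ?_⟩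
              simp only [hv.2.1, hv.2.2, if_false, Finset.mem_sdiff]
              exact ⟨hvx, hx⟩
            · obtain ⟨v, hv, rfl⟩ := Finset.mem_image.1 hx
              rw [Finset.mem_filter] at hv
              refine ⟨v, hv.1, ?_⟩
              simp only [τ]
              by_cases hva : v = a₁
              · simp [hva]
              · have : v = a₂ := by tauto
                subst this
                simp [hva])
    refine ⟨P, hP, hP1, ?_, ?_⟩
    · obtain ⟨w, hw, -⟩ := hP1.existsUnique a₁
      have := ht a₁ w hc₁ hw
      simp only [if_true, Finset.mem_singleton] at this
      exact this ▸ hw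
    · obtain ⟨w, hw, -⟩ := hP1.existsUnique a₂
      have := ht a₂ w hc₂ hw
      by_cases h : a₂ = a₁
      · simp only [h, if_true, Finset.mem_singleton] at this
        rw [← hab.1 h.symm, ← this]; exact hw
      · simp only [h, if_false, if_true, Finset.mem_singleton] at this
        exact this ▸ hw
  · right
    push Not at hall
    obtain ⟨S, hS, hlt⟩ := hall
    set T := S.biUnion fun v => G.neighborFinset v with hT
    have hTc : ∀ w ∈ T, c w = false := by
      intro w hw
      obtain ⟨v, hv, hvw⟩ := Finset.mem_biUnion.1 hw
      rw [mem_neighborFinset] at hvw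
      have h1 := hc _ _ hvw
      rw [(hS v hv).1] at h1
      simpa using h1.symm
    have hST : ∀ v w, v ∈ S → G.Adj v w → w ∈ T := fun v w hv hvw =>
      Finset.mem_biUnion.2 ⟨v, hv, by simpa using hvw⟩
    let X : Set V := {v | v ∈ S ∨ v ∈ T}
    have hX1 : {v | v ∈ X ∧ c v = true} = (S : Set V) := by
      ext v
      constructor
      · rintro ⟨h | h, h'⟩
        · exact h
        · rw [hTc v h] at h'; cases h'
      · intro h; exact ⟨Or.inl h, (hS v h).1⟩
    have hX2 : {v | v ∈ X ∧ c v = false} = (T : Set V) := by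
      ext v
      constructor
      · rintro ⟨h | h, h'⟩
        · rw [(hS v h).1] at h'; cases h'
        · exact h
      · intro h; exact ⟨Or.inr h, hTc v h⟩
    have hout : crossing G c true X = ∅ := by
      ext ⟨u, w⟩
      simp only [Set.mem_empty_iff_false, iff_false]
      rintro ⟨h1, h2 | h2, h3, h4⟩
      · exact h3 (Or.inr (hST u w h2 h4))
      · have := hTc u h2
        simp_all
    have hbal := crossing_balance hG hc X
    rw [hX1, hX2, hout, Set.ncard_coe_finset, Set.ncard_coe_finset, Set.ncard_empty] at hbal
    have hint : (T \ {b₁, b₂}).card + (T ∩ {b₁, b₂}).card = T.card :=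
      Finset.card_sdiff_add_card_inter _ _
    have ha : ∀ a, c a = true → (a = a₁ ∨ a = a₂) → a ∉ X := by
      rintro a hca ha (h | h)
      · rcases ha with ha | ha
        · exact (hS a h).2.1 ha
        · exact (hS a h).2.2 ha
      · rw [hTc a h] at hca; cases hca
    have hne : (T ∩ {b₁, b₂}).Nonempty := by
      rw [← Finset.card_pos]; omega
    have hpos : 0 < (crossing G c false X).ncard := by
      rw [Set.ncard_pos]
      obtain ⟨b, hb⟩ := hne
      simp only [Finset.mem_inter, Finset.mem_insert, Finset.mem_singleton] at hb
      rcases hb with ⟨hb, rfl | rfl⟩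
      · exact ⟨(b, a₁), hTc _ hb, Or.inr hb, ha _ hc₁ (Or.inl rfl), h₁.symm⟩
      · exact ⟨(b, a₂), hTc _ hb, Or.inr hb, ha _ hc₂ (Or.inr rfl), h₂.symm⟩
    have hle : (T ∩ {b₁, b₂}).card ≤ ({b₁, b₂} : Finset V).card :=
      Finset.card_le_card Finset.inter_subset_right
    have hle2 : ({b₁, b₂} : Finset V).card ≤ 2 := Finset.card_le_two
    have hbne : b₁ ≠ b₂ := by
      rintro rfl
      simp only [Finset.pair_eq_singleton, Finset.card_singleton] at *
      omega
    have hsub : T ∩ {b₁, b₂} = {b₁, b₂} :=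
      Finset.eq_of_subset_of_card_le Finset.inter_subset_right (by omega)
    have hb : ∀ b ∈ ({b₁, b₂} : Finset V), b ∈ T := fun b hb => by
      rw [← hsub] at hb; exact (Finset.mem_inter.1 hb).1
    exact ⟨X, ha _ hc₁ (Or.inl rfl), ha _ hc₂ (Or.inr rfl), Or.inr (hb _ (by simp)),
      Or.inr (hb _ (by simp)), hbne, hout, by omega⟩

lemma exists_perfectMatching_adj [Fintype V] {G : SimpleGraph V} (hG : IsRegularGraph 3 G)
    {c : V → Bool} (hc : ∀ u v, G.Adj u v → c u ≠ c v) {u v : V} (h : G.Adj u v) :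
    ∃ P : SimpleGraph V, P ≤ G ∧ IsRegularGraph 1 P ∧ P.Adj u v := by
  have key : ∀ {a b}, G.Adj a b → c a = true →
      ∃ P : SimpleGraph V, P ≤ G ∧ IsRegularGraph 1 P ∧ P.Adj a b := by
    intro a b hab hca
    rcases exists_perfectMatching_or_cut hG hc hab hab hca hca (by simp) with
      ⟨P, h1, h2, h3, -⟩ | ⟨X, -, -, -, -, h, -⟩
    · exact ⟨P, h1, h2, h3⟩
    · exact absurd rfl h
  cases hu : c u
  · have := hc _ _ h
    obtain ⟨P, h1, h2, h3⟩ := key h.symm (by simpa [hu] using this.symm)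
    exact ⟨P, h1, h2, h3.symm⟩
  · exact key h hu

/-- A brace has no three pairwise disjoint edges forming a cut, so it is not a star product. -/
lemma IsBrace.not_isStarProduct [Fintype V] {V₁ V₂ : Type} {G : SimpleGraph V} (hG : IsCubic G)
    (hb : IsBrace G) {G₁ : SimpleGraph V₁} {v₁ : V₁} {G₂ : SimpleGraph V₂} {v₂ : V₂} :
    ¬ IsStarProduct G G₁ v₁ G₂ v₂ := by
  rintro ⟨f, g, m, h3, -, hf, hg, hfg, -, hm, hadj⟩
  obtain ⟨-, hcol, -, hext⟩ := hb
  obtain ⟨c, hc⟩ := exists_bool_coloring hcol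
  have hn1 : ∀ {x}, G₁.Adj v₁ x → x ≠ v₁ := fun h => h.ne'
  have hn2 : ∀ {x}, G₁.Adj v₁ x → m x ≠ v₂ := fun h => (hm.mapsTo h : G₂.Adj v₂ _).ne'
  let X : Set V := f '' {x | x ≠ v₁}
  have hgX : ∀ {y}, y ≠ v₂ → g y ∉ X := by
    rintro y hy ⟨x, hx, h⟩
    exact hfg x y hx hy h
  have hout : outEdges G X = (fun x => (f x, g (m x))) '' G₁.neighborSet v₁ := by
    ext ⟨u, w⟩
    constructor
    · rintro ⟨h1, h2, h⟩
      rcases (hadj u w).1 h with ⟨x, y, hx, hy, -, rfl, rfl⟩ | ⟨x, y, hx, hy, -, rfl, rfl⟩ |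
        ⟨x, hx, ⟨rfl, rfl⟩ | ⟨rfl, rfl⟩⟩
      · exact absurd ⟨y, hy, rfl⟩ h2
      · exact absurd h1 (hgX hx)
      · exact ⟨x, hx, rfl⟩
      · exact absurd ⟨x, hn1 hx, rfl⟩ h2
    · rintro ⟨x, hx, h⟩
      simp only [Prod.mk.injEq] at h
      obtain ⟨rfl, rfl⟩ := h
      exact ⟨⟨x, hn1 hx, rfl⟩, hgX (hn2 hx), (hadj _ _).2 (Or.inr (Or.inr ⟨x, hx, Or.inl ⟨rfl, rfl⟩⟩))⟩
  have hout3 : (outEdges G X).ncard = 3 := by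
    rw [hout, Set.InjOn.ncard_image, h3]
    intro x hx y hy hxy
    exact hf (hn1 hx) (hn1 hy) (congrArg Prod.fst hxy)
  obtain ⟨x, hx, y, hy, hxy⟩ := (Set.one_lt_ncard (Set.finite_of_ncard_ne_zero
    (by rw [h3]; norm_num))).1 (show 1 < (G₁.neighborSet v₁).ncard by rw [h3]; norm_num)
  have hax : G.Adj (f x) (g (m x)) :=
    (hadj _ _).2 (Or.inr (Or.inr ⟨x, hx, Or.inl ⟨rfl, rfl⟩⟩))
  have hay : G.Adj (f y) (g (m y)) :=
    (hadj _ _).2 (Or.inr (Or.inr ⟨y, hy, Or.inl ⟨rfl, rfl⟩⟩))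
  have hfne : f x ≠ f y := fun h => hxy (hf (hn1 hx) (hn1 hy) h)
  have hgne : g (m x) ≠ g (m y) := fun h => hxy (hm.injOn hx hy (hg (hn2 hx) (hn2 hy) h))
  obtain ⟨P, hMP, hP⟩ := hext (G.subgraphOfAdj hax ⊔ G.subgraphOfAdj hay)
    (by
      apply Subgraph.IsMatching.sup
      · exact Subgraph.IsMatching.subgraphOfAdj hax
      · exact Subgraph.IsMatching.subgraphOfAdj hay
      · rw [support_subgraphOfAdj, support_subgraphOfAdj, Set.disjoint_left]
        have h1 := hfg x (m y) (hn1 hx) (hn2 hy)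
        have h2 := hfg y (m x) (hn1 hy) (hn2 hx)
        rintro z (rfl | rfl) (h | h)
        · exact hfne h
        · exact h1 h
        · exact h2 h.symm
        · exact hgne h)
    (by
      rw [Subgraph.edgeSet_sup, edgeSet_subgraphOfAdj, edgeSet_subgraphOfAdj]
      exact (Set.ncard_union_le _ _).trans (by simp))
  have hPr := isRegularGraph_spanningCoe hP
  have hPG : P.spanningCoe ≤ G := P.spanningCoe_le
  have hout2 : 2 ≤ (outEdges P.spanningCoe X).ncard := by
    rw [← Set.ncard_pair (a := (f x, g (m x))) (b := (f y, g (m y)))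
      (fun h => hfne (congrArg Prod.fst h))]
    apply Set.ncard_le_ncard _ (Set.toFinite _)
    rintro p (rfl | rfl)
    · exact ⟨⟨x, hn1 hx, rfl⟩, hgX (hn2 hx), hMP.2 (by simp)⟩
    · exact ⟨⟨y, hn1 hy, rfl⟩, hgX (hn2 hy), hMP.2 (by simp)⟩
  rw [ncard_outEdges _ c] at hout3 hout2
  have b1 := crossing_balance hG hc X
  have b2 := crossing_balance hPr (fun u v h => hc u v (hPG h)) X
  have m1 := crossing_mono hPG c true X
  have m2 := crossing_mono hPG c false X
  omega

end Brace

section Cut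

variable {V : Type}

lemma ncard_outEdges_compl (G : SimpleGraph V) (X : Set V) :
    (outEdges G Xᶜ).ncard = (outEdges G X).ncard := by
  rw [← Set.ncard_image_of_injective (outEdges G X) (Prod.swap_injective (α := V) (β := V))]
  congr 1
  ext ⟨u, v⟩
  simp only [outEdges, Set.mem_image, Set.mem_ofPred_eq, Prod.exists, Prod.swap_prod_mk,
    Prod.mk.injEq, Set.mem_compl_iff, not_not]
  constructor
  · rintro ⟨h1, h2, h3⟩
    exact ⟨v, u, ⟨h2, h1, h3.symm⟩, rfl, rfl⟩
  · rintro ⟨a, b, ⟨h1, h2, h3⟩, rfl, rfl⟩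
    exact ⟨h2, h1, h3.symm⟩

/-- A cubic bipartite graph in which the complement of every perfect matching is connected is
3-edge-connected. -/
lemma three_le_ncard_outEdges [Fintype V] {G : SimpleGraph V} (hG : IsRegularGraph 3 G)
    {c : V → Bool} (hc : ∀ u v, G.Adj u v → c u ≠ c v)
    (hham : ∀ P : SimpleGraph V, P ≤ G → IsRegularGraph 1 P → (G \ P).Connected)
    {Y : Set V} {y z : V} (hy : y ∈ Y) (hz : z ∉ Y) : 3 ≤ (outEdges G Y).ncard := by
  by_contra! hlt
  have hedge : ∃ u v, G.Adj u v ∧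
      (0 < (crossing G c true Y).ncard → (u, v) ∈ crossing G c true Y) := by
    by_cases h : 0 < (crossing G c true Y).ncard
    · obtain ⟨⟨u, v⟩, huv⟩ := (Set.ncard_pos (Set.toFinite _)).1 h
      exact ⟨u, v, huv.2.2.2, fun _ => huv⟩
    · have : (G.neighborSet y).Nonempty := by
        rw [← Set.ncard_pos (Set.toFinite _), hG y]; norm_num
      obtain ⟨v, hv⟩ := this
      exact ⟨y, v, hv, fun h' => absurd h' h⟩
  obtain ⟨u, v, huv, hcr⟩ := hedge
  obtain ⟨P, hPG, hP, hPuv⟩ := exists_perfectMatching_adj hG hc huv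
  have b1 := crossing_balance hG hc Y
  have b2 := crossing_balance hP (fun u v h => hc u v (hPG h)) Y
  have m1 := crossing_mono hPG c true Y
  have m2 := crossing_mono hPG c false Y
  have n1 := ncard_outEdges G c Y
  have n2 := ncard_outEdges P c Y
  have hpos : 0 < (crossing G c true Y).ncard → 0 < (crossing P c true Y).ncard := by
    intro h
    have := hcr h
    exact (Set.ncard_pos (Set.toFinite _)).2 ⟨(u, v), this.1, this.2.1, this.2.2.1, hPuv⟩
  have hsub : outEdges P Y ⊆ outEdges G Y := fun p hp => ⟨hp.1, hp.2.1, hPG hp.2.2⟩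
  have heq : outEdges P Y = outEdges G Y :=
    Set.eq_of_subset_of_ncard_le hsub (by omega) (Set.toFinite _)
  obtain ⟨p⟩ := (hham P hPG hP).preconnected y z
  obtain ⟨d, -, hd1, hd2⟩ := p.exists_boundary_dart Y hy hz
  have hd := d.adj
  rw [SimpleGraph.sdiff_adj] at hd
  have : (d.fst, d.snd) ∈ outEdges G Y := ⟨hd1, hd2, hd.1⟩
  rw [← heq] at this
  exact hd.2 this.2.2

/-- In a 3-edge-connected cubic graph, two edges of a cut of size three do not share an inner
end, unless that end is the whole side of the cut. -/
lemma eq_of_adj_of_ncard_outEdges_eq_three [Finite V] {G : SimpleGraph V}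
    (hG : IsRegularGraph 3 G)
    (h3 : ∀ (Y : Set V) (y z : V), y ∈ Y → z ∉ Y → 3 ≤ (outEdges G Y).ncard)
    {X : Set V} (hX : (outEdges G X).ncard = 3) (hnt : ∀ u, ∃ b ∈ X, b ≠ u) {u v w : V}
    (hu : u ∈ X) (hv : v ∉ X) (hw : w ∉ X) (huv : G.Adj u v) (huw : G.Adj u w) : v = w := by
  by_contra hvw
  obtain ⟨b, hb, hbu⟩ := hnt u
  have hle := h3 (X \ {u}) b u ⟨hb, hbu⟩ (by simp)
  have hsub : outEdges G (X \ {u}) ⊆ (outEdges G X \ {(u, v), (u, w)}) ∪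
      (fun x => (x, u)) '' (G.neighborSet u \ {v, w}) := by
    rintro ⟨x, y⟩ ⟨⟨hx, hxu⟩, hy, hxy⟩
    have hxu' : x ≠ u := hxu
    simp only [Set.mem_union]
    by_cases hyu : y = u
    · right
      subst hyu
      refine ⟨x, ⟨hxy.symm, ?_⟩, rfl⟩
      rintro (rfl | rfl)
      · exact hv hx
      · exact hw hx
    · left
      refine ⟨⟨hx, fun h => hy ⟨h, hyu⟩, hxy⟩, ?_⟩
      rintro (h | h) <;> exact hxu' (congrArg Prod.fst h)
  have h1 : (outEdges G X \ {(u, v), (u, w)}).ncard = 1 := by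
    rw [Set.ncard_sdiff _ (Set.toFinite _), hX, Set.ncard_pair (by simpa using hvw)]
    rintro p (rfl | rfl)
    · exact ⟨hu, hv, huv⟩
    · exact ⟨hu, hw, huw⟩
  have h2 : (G.neighborSet u \ {v, w}).ncard = 1 := by
    rw [Set.ncard_sdiff _ (Set.toFinite _), hG u, Set.ncard_pair hvw]
    rintro p (rfl | rfl)
    · exact huv
    · exact huw
  have h4 := Set.ncard_le_ncard hsub (Set.toFinite _)
  have h5 := Set.ncard_union_le (outEdges G X \ {(u, v), (u, w)})
    ((fun x => (x, u)) '' (G.neighborSet u \ {v, w}))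
  have h6 := Set.ncard_image_le (f := fun x => (x, u)) (Set.toFinite (G.neighborSet u \ {v, w}))
  omega

/-- The cut of `X` consists of three pairwise disjoint edges, whose ends in `X` all have
colour `false`. -/
structure IsMatchingCut (G : SimpleGraph V) (c : V → Bool) (X : Set V) : Prop where
  color : ∀ u v, u ∈ X → v ∉ X → G.Adj u v → c u = false
  ncard : (outEdges G X).ncard = 3
  inner : ∀ u v w, u ∈ X → v ∉ X → w ∉ X → G.Adj u v → G.Adj u w → v = w
  outer : ∀ u v w, u ∉ X → v ∈ X → w ∈ X → G.Adj u v → G.Adj u w → v = w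

lemma IsMatchingCut.compl {G : SimpleGraph V} {c : V → Bool} {X : Set V}
    (hc : ∀ u v, G.Adj u v → c u ≠ c v) (h : IsMatchingCut G c X) :
    IsMatchingCut G (fun v => !c v) Xᶜ where
  color u v hu hv huv := by
    have h1 := h.color v u (not_not.1 hv) hu huv.symm
    have h2 := hc u v huv
    rw [h1] at h2
    simpa using h2
  ncard := (ncard_outEdges_compl G X).trans h.ncard
  inner u v w hu hv hw := h.outer u v w hu (not_not.1 hv) (not_not.1 hw)
  outer u v w hu hv hw := h.inner u v w (not_not.1 hu) hv hw

end Cut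

section Contract

variable {V : Type}

/-- The graph obtained from `H` by contracting the complement of `X` to the vertex `none`. -/
def contractCompl (H : SimpleGraph V) (X : Set V) : SimpleGraph (Option X) where
  Adj
    | some u, some v => H.Adj u v
    | some u, none => ∃ w, w ∉ X ∧ H.Adj u w
    | none, some u => ∃ w, w ∉ X ∧ H.Adj u w
    | none, none => False
  symm := ⟨by
    rintro (_ | u) (_ | v) h
    · exact h
    · exact h
    · exact h
    · exact H.symm.symm _ _ h⟩
  loopless := ⟨by
    rintro (_ | u) h
    · exact h
    · exact H.loopless.irrefl _ h⟩

open Classical in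
/-- The contraction map of `contractCompl`. -/
noncomputable def contractMap (X : Set V) (v : V) : Option X :=
  if h : v ∈ X then some ⟨v, h⟩ else none

lemma contractMap_of_mem {X : Set V} {v : V} (h : v ∈ X) : contractMap X v = some ⟨v, h⟩ :=
  dif_pos h

lemma contractMap_of_notMem {X : Set V} {v : V} (h : v ∉ X) : contractMap X v = none :=
  dif_neg h

lemma contractMap_eq_some {X : Set V} {v : V} {x : X} : contractMap X v = some x ↔ v = x := by
  constructor
  · intro h
    by_cases hv : v ∈ X
    · rw [contractMap_of_mem hv, Option.some_inj] at h
      exact congrArg Subtype.val h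
    · rw [contractMap_of_notMem hv] at h; cases h
  · rintro rfl
    exact contractMap_of_mem x.2

lemma contractMap_eq_none {X : Set V} {v : V} : contractMap X v = none ↔ v ∉ X := by
  constructor
  · intro h hv
    rw [contractMap_of_mem hv] at h; cases h
  · exact contractMap_of_notMem

variable {G : SimpleGraph V} {c : V → Bool} {X : Set V}

lemma IsMatchingCut.isRegularGraph_contractCompl (hG : IsRegularGraph 3 G)
    (h : IsMatchingCut G c X) : IsRegularGraph 3 (contractCompl G X) := by
  rintro (_ | u)
  · have : (contractCompl G X).neighborSet none =
        (fun p => contractMap X p.1) '' outEdges G X := by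
      ext (_ | w)
      · constructor
        · intro hw; exact hw.elim
        · rintro ⟨p, hp, hw⟩
          exact absurd hp.1 (contractMap_eq_none.1 hw)
      · constructor
        · rintro ⟨v, hv, hwv⟩
          exact ⟨(w, v), ⟨w.2, hv, hwv⟩, contractMap_of_mem w.2⟩
        · rintro ⟨⟨x, v⟩, ⟨hx, hv, hxv⟩, hw⟩
          have : x = w := contractMap_eq_some.1 hw
          subst this
          exact ⟨v, hv, hxv⟩
    rw [this, Set.InjOn.ncard_image, h.ncard]
    rintro ⟨x, v⟩ ⟨hx, hv, hxv⟩ ⟨y, w⟩ ⟨hy, hw, hyw⟩ hxy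
    have : x = y := by
      have h1 : contractMap X x = contractMap X y := hxy
      rw [contractMap_of_mem hy] at h1
      exact contractMap_eq_some.1 h1
    subst this
    rw [h.inner x v w hx hv hw hxv hyw]
  · have : (contractCompl G X).neighborSet (some u) = contractMap X '' G.neighborSet u := by
      ext (_ | w)
      · constructor
        · rintro ⟨v, hv, huv⟩
          exact ⟨v, huv, contractMap_of_notMem hv⟩
        · rintro ⟨v, huv, hv⟩
          exact ⟨v, contractMap_eq_none.1 hv, huv⟩
      · constructor
        · intro hw
          exact ⟨w, hw, contractMap_of_mem w.2⟩
        · rintro ⟨v, huv, hv⟩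
          have : v = w := contractMap_eq_some.1 hv
          subst this
          exact huv
    rw [this, Set.InjOn.ncard_image, hG u]
    intro v hv w hw hvw
    by_cases hw' : w ∈ X
    · rw [contractMap_of_mem hw'] at hvw
      exact contractMap_eq_some.1 hvw
    · rw [contractMap_of_notMem hw'] at hvw
      exact h.inner u v w u.2 (contractMap_eq_none.1 hvw) hw' hv hw

lemma IsMatchingCut.exists_color_contractCompl (hc : ∀ u v, G.Adj u v → c u ≠ c v)
    (h : IsMatchingCut G c X) :
    ∃ d : Option X → Bool, ∀ u v, (contractCompl G X).Adj u v → d u ≠ d v := by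
  refine ⟨fun o => o.elim true fun u => c u, ?_⟩
  rintro (_ | u) (_ | v) huv
  · exact huv.elim
  · obtain ⟨w, hw, hvw⟩ := huv
    simp [h.color v w v.2 hw hvw]
  · obtain ⟨w, hw, hvw⟩ := huv
    simp [h.color u w u.2 hw hvw]
  · exact hc _ _ huv

/-- Contracting one side of a matching cut preserves the property that the complement of every
perfect matching is connected. -/
lemma IsMatchingCut.connected_contractCompl_sdiff [Fintype V] (hG : IsRegularGraph 3 G)
    (hc : ∀ u v, G.Adj u v → c u ≠ c v)
    (hham : ∀ P : SimpleGraph V, P ≤ G → IsRegularGraph 1 P → (G \ P).Connected)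
    (h : IsMatchingCut G c X) (P₁ : SimpleGraph (Option X)) (hP₁ : P₁ ≤ contractCompl G X)
    (hr₁ : IsRegularGraph 1 P₁) : (contractCompl G X \ P₁).Connected := by
  classical
  obtain ⟨x, hx, hxu⟩ := hr₁.existsUnique none
  rcases x with _ | x
  · exact (hx.ne rfl).elim
  obtain ⟨y, hy, hxy⟩ : ∃ w, w ∉ X ∧ G.Adj x w := hP₁ hx
  have h' := h.compl hc
  obtain ⟨d, hd⟩ := h'.exists_color_contractCompl (fun u v huv => by
    have := hc u v huv
    simpa using this)
  obtain ⟨P₂, hP₂, hr₂, hy₂⟩ := exists_perfectMatching_adj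
    (h'.isRegularGraph_contractCompl hG) hd
    (u := none) (v := some ⟨y, hy⟩) ⟨x, not_not.2 x.2, hxy.symm⟩
  have hy₂u : ∀ z, P₂.Adj none z → z = some ⟨y, hy⟩ := fun z hz =>
    (hr₂.existsUnique none).unique hz hy₂
  let P : SimpleGraph V :=
    { Adj := fun u v => (∃ (hu : u ∈ X) (hv : v ∈ X), P₁.Adj (some ⟨u, hu⟩) (some ⟨v, hv⟩)) ∨
        (∃ (hu : u ∈ Xᶜ) (hv : v ∈ Xᶜ), P₂.Adj (some ⟨u, hu⟩) (some ⟨v, hv⟩)) ∨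
        (u = x ∧ v = y) ∨ (u = y ∧ v = x)
      symm := ⟨by
        rintro u v (⟨hu, hv, h⟩ | ⟨hu, hv, h⟩ | ⟨hu, hv⟩ | ⟨hu, hv⟩)
        · exact Or.inl ⟨hv, hu, h.symm⟩
        · exact Or.inr (Or.inl ⟨hv, hu, h.symm⟩)
        · exact Or.inr (Or.inr (Or.inr ⟨hv, hu⟩))
        · exact Or.inr (Or.inr (Or.inl ⟨hv, hu⟩))⟩
      loopless := ⟨by
        rintro u (⟨hu, hv, h⟩ | ⟨hu, hv, h⟩ | ⟨hu, hv⟩ | ⟨hu, hv⟩)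
        · exact h.ne rfl
        · exact h.ne rfl
        · exact hxy.ne (hu.symm.trans hv)
        · exact hxy.ne (hv.symm.trans hu)⟩ }
  have hPG : P ≤ G := by
    rintro u v (⟨hu, hv, h⟩ | ⟨hu, hv, h⟩ | ⟨rfl, rfl⟩ | ⟨rfl, rfl⟩)
    · exact hP₁ h
    · exact hP₂ h
    · exact hxy
    · exact hxy.symm
  have hP : IsRegularGraph 1 P := by
    apply isRegularGraph_one_of_existsUnique
    intro v
    by_cases hv : v ∈ X
    · obtain ⟨w, hw, hwu⟩ := hr₁.existsUnique (some ⟨v, hv⟩)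
      rcases w with _ | w
      · have hvx : some ⟨v, hv⟩ = some x := hxu _ hw.symm
        have hvx' : v = x := congrArg Subtype.val (Option.some_inj.1 hvx)
        refine ⟨y, Or.inr (Or.inr (Or.inl ⟨hvx', rfl⟩)), ?_⟩
        rintro z (⟨_, hz, hvz⟩ | ⟨hv', _, _⟩ | ⟨_, hz⟩ | ⟨hz, _⟩)
        · have := hwu _ hvz
          cases this
        · exact absurd hv hv'
        · exact hz
        · exact absurd (hz ▸ hv) hy
      · refine ⟨w, Or.inl ⟨hv, w.2, hw⟩, ?_⟩
        rintro z (⟨_, hz, hvz⟩ | ⟨hv', _, _⟩ | ⟨hvx, hz⟩ | ⟨hz, _⟩)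
        · exact congrArg Subtype.val (Option.some_inj.1 (hwu _ hvz))
        · exact absurd hv hv'
        · have hvx' : (⟨v, hv⟩ : X) = x := Subtype.ext hvx
          rw [hvx'] at hwu
          have := hwu _ hx.symm
          cases this
        · exact absurd (hz ▸ hv) hy
    · obtain ⟨w, hw, hwu⟩ := hr₂.existsUnique (some ⟨v, hv⟩)
      rcases w with _ | w
      · have hvy : some (⟨v, hv⟩ : ↥Xᶜ) = some ⟨y, hy⟩ := hy₂u _ hw.symm
        have hvy' : v = y := congrArg Subtype.val (Option.some_inj.1 hvy)
        refine ⟨x, Or.inr (Or.inr (Or.inr ⟨hvy', rfl⟩)), ?_⟩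
        rintro z (⟨hv', _, _⟩ | ⟨_, hz, hvz⟩ | ⟨hz, _⟩ | ⟨_, hz⟩)
        · exact absurd hv' hv
        · have := hwu _ hvz
          cases this
        · exact absurd (hz ▸ x.2) hv
        · exact hz
      · refine ⟨w, Or.inr (Or.inl ⟨hv, w.2, hw⟩), ?_⟩
        rintro z (⟨hv', _, _⟩ | ⟨_, hz, hvz⟩ | ⟨hz, _⟩ | ⟨hvy, hz⟩)
        · exact absurd hv' hv
        · exact congrArg Subtype.val (Option.some_inj.1 (hwu _ hvz))
        · exact absurd (hz ▸ x.2) hv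
        · subst hvy
          have := hwu _ hy₂.symm
          cases this
  have hcon := hham P hPG hP
  have hstep : ∀ u v, (G \ P).Adj u v →
      (contractCompl G X \ P₁).Reachable (contractMap X u) (contractMap X v) := by
    have hcross : ∀ u v, u ∈ X → v ∉ X → (G \ P).Adj u v →
        (contractCompl G X \ P₁).Reachable (contractMap X u) (contractMap X v) := by
      intro u v hu hv huv
      rw [SimpleGraph.sdiff_adj] at huv
      rw [contractMap_of_mem hu, contractMap_of_notMem hv]
      refine Adj.reachable ?_
      rw [SimpleGraph.sdiff_adj]
      refine ⟨⟨v, hv, huv.1⟩, fun hP' => huv.2 ?_⟩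
      have hux : some ⟨u, hu⟩ = some x := hxu _ hP'.symm
      have hux' : u = x := congrArg Subtype.val (Option.some_inj.1 hux)
      subst hux'
      exact Or.inr (Or.inr (Or.inl ⟨rfl, h.inner x v y hu hv hy huv.1 hxy⟩))
    intro u v huv
    by_cases hu : u ∈ X <;> by_cases hv : v ∈ X
    · rw [SimpleGraph.sdiff_adj] at huv
      rw [contractMap_of_mem hu, contractMap_of_mem hv]
      refine Adj.reachable ?_
      rw [SimpleGraph.sdiff_adj]
      exact ⟨huv.1, fun hP' => huv.2 (Or.inl ⟨hu, hv, hP'⟩)⟩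
    · exact hcross u v hu hv huv
    · exact (hcross v u hv hu huv.symm).symm
    · rw [contractMap_of_notMem hu, contractMap_of_notMem hv]
  have hreach : ∀ u v, (contractCompl G X \ P₁).Reachable (contractMap X u) (contractMap X v) := by
    intro u v
    obtain ⟨p⟩ := hcon.preconnected u v
    induction p with
    | nil => rfl
    | cons huv _ ih => exact (hstep _ _ huv).trans ih
  have hsurj : Function.Surjective (contractMap X) := by
    rintro (_ | w)
    · exact ⟨y, contractMap_of_notMem hy⟩
    · exact ⟨w, contractMap_of_mem w.2⟩
  have : Nonempty (Option X) := ⟨none⟩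
  refine ⟨fun a b => ?_⟩
  obtain ⟨u, rfl⟩ := hsurj a
  obtain ⟨v, rfl⟩ := hsurj b
  exact hreach u v

/-- A graph with a matching cut is the star product of its two contractions. -/
lemma IsMatchingCut.isStarProduct (hG : IsRegularGraph 3 G)
    (hc : ∀ u v, G.Adj u v → c u ≠ c v) (h : IsMatchingCut G c X) (v₀ : V) :
    IsStarProduct G (contractCompl G X) none (contractCompl G Xᶜ) none := by
  classical
  have h' := h.compl hc
  have hout : ∀ u : X, (∃ w, w ∉ X ∧ G.Adj u w) → ∃ w : ↥Xᶜ, G.Adj u w :=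
    fun u ⟨w, hw, huw⟩ => ⟨⟨w, hw⟩, huw⟩
  let m : Option X → Option ↥Xᶜ := fun o => o.bind fun u =>
    if hu : ∃ w : ↥Xᶜ, G.Adj u w then some hu.choose else none
  have hm : ∀ (u : X) (w : ↥Xᶜ), G.Adj u w → m (some u) = some w := by
    intro u w huw
    have hu : ∃ w : ↥Xᶜ, G.Adj u w := ⟨w, huw⟩
    have : m (some u) = some hu.choose := dif_pos hu
    rw [this]
    exact congrArg some (Subtype.ext (h.inner u _ _ u.2 hu.choose.2 w.2 hu.choose_spec huw))
  refine ⟨fun o => o.elim v₀ fun u => u, fun o => o.elim v₀ fun u => u, m,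
    h.isRegularGraph_contractCompl hG none, h'.isRegularGraph_contractCompl hG none,
    ?_, ?_, ?_, ?_, ⟨?_, ?_, ?_⟩, ?_⟩
  · rintro (_ | u) hu (_ | v) hv huv
    · rfl
    · exact absurd rfl hu
    · exact absurd rfl hv
    · exact congrArg some (Subtype.ext huv)
  · rintro (_ | u) hu (_ | v) hv huv
    · rfl
    · exact absurd rfl hu
    · exact absurd rfl hv
    · exact congrArg some (Subtype.ext huv)
  · rintro (_ | u) (_ | v) hu hv huv
    · exact hu rfl
    · exact hu rfl
    · exact hv rfl
    · have huv' : (u : V) = v := huv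
      exact v.2 (huv' ▸ u.2)
  · intro v
    by_cases hv : v ∈ X
    · exact Or.inl ⟨some ⟨v, hv⟩, by simp, rfl⟩
    · exact Or.inr ⟨some ⟨v, hv⟩, by simp, rfl⟩
  · rintro (_ | u) hu
    · exact hu.elim
    · obtain ⟨w, huw⟩ := hout u hu
      rw [hm u w huw]
      exact ⟨u, not_not.2 u.2, huw.symm⟩
  · rintro (_ | u) hu (_ | v) hv huv
    · rfl
    · exact hu.elim
    · exact hv.elim
    · obtain ⟨w, huw⟩ := hout u hu
      obtain ⟨z, hvz⟩ := hout v hv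
      rw [hm u w huw, hm v z hvz, Option.some_inj] at huv
      subst huv
      exact congrArg some (Subtype.ext (h.outer w u v w.2 u.2 v.2 huw.symm hvz.symm))
  · rintro (_ | w) hw
    · exact hw.elim
    · obtain ⟨u, hu, hwu⟩ := hw
      have hu' : u ∈ X := not_not.1 hu
      exact ⟨some ⟨u, hu'⟩, ⟨w, w.2, hwu.symm⟩, hm ⟨u, hu'⟩ w hwu.symm⟩
  · intro a b
    constructor
    · intro hab
      by_cases ha : a ∈ X <;> by_cases hb : b ∈ X
      · exact Or.inl ⟨some ⟨a, ha⟩, some ⟨b, hb⟩, by simp, by simp, hab, rfl, rfl⟩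
      · refine Or.inr (Or.inr ⟨some ⟨a, ha⟩, ⟨b, hb, hab⟩, Or.inl ⟨rfl, ?_⟩⟩)
        rw [hm ⟨a, ha⟩ ⟨b, hb⟩ hab]; rfl
      · refine Or.inr (Or.inr ⟨some ⟨b, hb⟩, ⟨a, ha, hab.symm⟩, Or.inr ⟨rfl, ?_⟩⟩)
        rw [hm ⟨b, hb⟩ ⟨a, ha⟩ hab.symm]; rfl
      · exact Or.inr (Or.inl ⟨some ⟨a, ha⟩, some ⟨b, hb⟩, by simp, by simp, hab, rfl, rfl⟩)
    · rintro (⟨_ | u, _ | v, hu, hv, huv, rfl, rfl⟩ | ⟨_ | u, _ | v, hu, hv, huv, rfl, rfl⟩ |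
        ⟨_ | u, hu, huv⟩)
      · exact absurd rfl hu
      · exact absurd rfl hu
      · exact absurd rfl hv
      · exact huv
      · exact absurd rfl hu
      · exact absurd rfl hu
      · exact absurd rfl hv
      · exact huv
      · exact hu.elim
      · obtain ⟨w, huw⟩ := hout u hu
        rw [hm u w huw] at huv
        rcases huv with ⟨rfl, rfl⟩ | ⟨rfl, rfl⟩
        · exact huw
        · exact huw.symm

end Contract

section Decomposition

variable {V : Type} [Fintype V] {G : SimpleGraph V}

lemma exists_pair_of_ncard_le_two {α : Type*} {s : Set α} (hf : s.Finite) (hs : s.Nonempty)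
    (h : s.ncard ≤ 2) : ∃ a ∈ s, ∃ b ∈ s, ∀ x ∈ s, x = a ∨ x = b := by
  obtain ⟨a, ha⟩ := hs
  by_cases hb : ∃ b ∈ s, b ≠ a
  · obtain ⟨b, hb, hba⟩ := hb
    refine ⟨a, ha, b, hb, ?_⟩
    have hsub : ({a, b} : Set α) ⊆ s := by
      rintro x (rfl | rfl) <;> assumption
    have := Set.eq_of_subset_of_ncard_le hsub (by rwa [Set.ncard_pair hba.symm]) hf
    intro x hx
    rw [← this] at hx
    exact hx
  · push Not at hb
    exact ⟨a, ha, a, ha, fun x hx => Or.inl (hb x hx)⟩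

/-- A cubic bipartite graph in which the complement of every perfect matching is connected is a
brace or has a matching cut both sides of which have at least two vertices. -/
lemma isBrace_or_exists_isMatchingCut (hG : IsRegularGraph 3 G) (hcol : G.Colorable 2)
    (hham : ∀ P : SimpleGraph V, P ≤ G → IsRegularGraph 1 P → (G \ P).Connected) :
    IsBrace G ∨ ∃ (c : V → Bool) (X : Set V), (∀ u v, G.Adj u v → c u ≠ c v) ∧
      IsMatchingCut G c X ∧ 1 < X.ncard ∧ 1 < Xᶜ.ncard := by
  classical
  obtain ⟨c, hc⟩ := exists_bool_coloring hcol
  by_cases hcut : ∃ (a₁ b₁ a₂ b₂ : V) (X : Set V), a₁ ∉ X ∧ a₂ ∉ X ∧ b₁ ∈ X ∧ b₂ ∈ X ∧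
      a₁ ≠ a₂ ∧ b₁ ≠ b₂ ∧ crossing G c true X = ∅ ∧ (crossing G c false X).ncard = 3
  · right
    obtain ⟨a₁, b₁, a₂, b₂, X, ha₁, ha₂, hb₁, hb₂, ha, hb, h0, h3⟩ := hcut
    have hX : (outEdges G X).ncard = 3 := by
      rw [ncard_outEdges G c, h0, h3, Set.ncard_empty]
    have hX' : (outEdges G Xᶜ).ncard = 3 := (ncard_outEdges_compl G X).trans hX
    have hec : ∀ (Y : Set V) (y z : V), y ∈ Y → z ∉ Y → 3 ≤ (outEdges G Y).ncard :=
      fun Y y z hy hz => three_le_ncard_outEdges hG hc hham hy hz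
    refine ⟨c, X, hc, ⟨?_, hX, ?_, ?_⟩, ?_, ?_⟩
    · intro u v hu hv huv
      by_contra hcu
      have : (u, v) ∈ crossing G c true X := ⟨by simpa using hcu, hu, hv, huv⟩
      rw [h0] at this
      exact this
    · intro u v w hu hv hw
      refine eq_of_adj_of_ncard_outEdges_eq_three hG hec hX (fun u => ?_) hu hv hw
      by_cases h : b₁ = u
      · exact ⟨b₂, hb₂, fun h' => hb (h.trans h'.symm)⟩
      · exact ⟨b₁, hb₁, h⟩
    · intro u v w hu hv hw
      refine eq_of_adj_of_ncard_outEdges_eq_three hG hec hX' (fun u => ?_) hu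
        (not_not.2 hv) (not_not.2 hw)
      by_cases h : a₁ = u
      · exact ⟨a₂, ha₂, fun h' => ha (h.trans h'.symm)⟩
      · exact ⟨a₁, ha₁, h⟩
    · exact (Set.one_lt_ncard (Set.toFinite _)).2 ⟨b₁, hb₁, b₂, hb₂, hb⟩
    · exact (Set.one_lt_ncard (Set.toFinite _)).2 ⟨a₁, ha₁, a₂, ha₂, ha⟩
  · left
    have hne : Nonempty V := by
      by_contra hempty
      rw [not_nonempty_iff] at hempty
      exact hempty.elim (hham ⊥ bot_le fun v => hempty.elim v).nonempty.some
    obtain ⟨v₀⟩ := hne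
    obtain ⟨w₀, hw₀⟩ : (G.neighborSet v₀).Nonempty := by
      rw [← Set.ncard_pos (Set.toFinite _), hG v₀]; norm_num
    obtain ⟨P₀, hP₀, hr₀, -⟩ := exists_perfectMatching_adj hG hc hw₀
    refine ⟨(hham P₀ hP₀ hr₀).mono sdiff_le, hcol, ?_, ?_⟩
    · rw [← Set.ncard_univ]
      calc 4 = (insert v₀ (G.neighborSet v₀)).ncard := by
            rw [Set.ncard_insert_of_notMem (by simp) (Set.toFinite _), hG v₀]
        _ ≤ _ := Set.ncard_le_ncard (Set.subset_univ _) (Set.toFinite _)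
    · intro M hM hM2
      suffices ∃ P : SimpleGraph V, P ≤ G ∧ IsRegularGraph 1 P ∧ ∀ u v, M.Adj u v → P.Adj u v by
        obtain ⟨P, hPG, hP, hMP⟩ := this
        refine ⟨SimpleGraph.toSubgraph P hPG, ⟨fun _ _ => trivial, fun u v => hMP u v⟩, ?_⟩
        rw [Subgraph.isPerfectMatching_iff]
        exact hP.existsUnique
      by_cases hMe : M.edgeSet.Nonempty
      · obtain ⟨e₁, he₁, e₂, he₂, hall⟩ := exists_pair_of_ncard_le_two (Set.toFinite _) hMe hM2
        have orient : ∀ e ∈ M.edgeSet, ∃ a b, e = s(a, b) ∧ M.Adj a b ∧ c a = true := by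
          intro e
          induction e using Sym2.ind with
          | _ a b =>
            intro he
            rw [Subgraph.mem_edgeSet] at he
            cases hca : c a
            · have h1 := hc _ _ he.adj_sub
              exact ⟨b, a, Sym2.eq_swap, he.symm, by simpa [hca] using h1.symm⟩
            · exact ⟨a, b, rfl, he, hca⟩
        obtain ⟨a₁, b₁, rfl, h₁, hc₁⟩ := orient e₁ he₁
        obtain ⟨a₂, b₂, rfl, h₂, hc₂⟩ := orient e₂ he₂
        have huniq : ∀ {a b b'}, M.Adj a b → M.Adj a b' → b = b' := fun h h' =>
          hM.eq_of_adj_left h h'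
        have hab : a₁ = a₂ ↔ b₁ = b₂ := by
          constructor
          · rintro rfl; exact huniq h₁ h₂
          · rintro rfl; exact huniq h₁.symm h₂.symm
        rcases exists_perfectMatching_or_cut hG hc h₁.adj_sub h₂.adj_sub hc₁ hc₂ hab with
          ⟨P, hPG, hP, hP₁, hP₂⟩ | ⟨X, hX1, hX2, hX3, hX4, hX5, hX6, hX7⟩
        · refine ⟨P, hPG, hP, fun u v huv => ?_⟩
          rcases hall _ (Subgraph.mem_edgeSet.2 huv) with h | h
          · rw [← mem_edgeSet, h]; exact hP₁
          · rw [← mem_edgeSet, h]; exact hP₂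
        · exact absurd ⟨a₁, b₁, a₂, b₂, X, hX1, hX2, hX3, hX4, fun h => hX5 (hab.1 h), hX5, hX6,
            hX7⟩ hcut
      · exact ⟨P₀, hP₀, hr₀, fun u v huv => absurd ⟨s(u, v), huv⟩ hMe⟩

end Decomposition

lemma colorable_two_of_bool {V : Type} {G : SimpleGraph V} {c : V → Bool}
    (hc : ∀ u v, G.Adj u v → c u ≠ c v) : G.Colorable 2 := by
  have := (SimpleGraph.Coloring.mk c fun {u v} h => hc u v h).colorable
  simpa using this

lemma constructible_of_brace_classification
    (hB : ∀ (V : Type) [Fintype V] (G : SimpleGraph V),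
        IsCubic G → IsBrace G → IsTwoFactorHamiltonian G →
        Nonempty (G ≃g completeBipartiteGraph (Fin 3) (Fin 3)) ∨
          Nonempty (G ≃g heawoodGraph)) (n : ℕ) :
    ∀ (V : Type) [Fintype V] (G : SimpleGraph V), Nat.card V = n →
      IsCubic G → G.Colorable 2 → IsTwoFactorHamiltonian G → Constructible G := by
  induction n using Nat.strong_induction_on with
  | _ n ih =>
    intro V _ G hn hG hcol hham
    have hham' := (isTwoFactorHamiltonian_iff hG).1 hham
    rcases isBrace_or_exists_isMatchingCut hG hcol hham' with hb | ⟨c, X, hc, hX, h1, h2⟩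
    · rcases hB V G hG hb hham with h | h
      · exact .k33 G h
      · exact .heawood G h
    · have hX' := hX.compl hc
      have hc' : ∀ u v, G.Adj u v → (!c u) ≠ !c v := fun u v huv => by
        simpa using hc u v huv
      have hadd := Set.ncard_add_ncard_compl X
      have step : ∀ (d : V → Bool) (Y : Set V), (∀ u v, G.Adj u v → d u ≠ d v) →
          IsMatchingCut G d Y → Y.ncard + 1 < n → Constructible (contractCompl G Y) := by
        intro d Y hd hY hlt
        have hreg := hY.isRegularGraph_contractCompl hG
        obtain ⟨e, he⟩ := hY.exists_color_contractCompl hd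
        have := Fintype.ofFinite (Option Y)
        refine ih _ hlt (Option Y) _ ?_ hreg (colorable_two_of_bool he)
          ((isTwoFactorHamiltonian_iff hreg).2
            (hY.connected_contractCompl_sdiff hG hd hham'))
        rw [Finite.card_option, Nat.card_coe_set_eq]
      obtain ⟨v₀, -⟩ := Set.nonempty_of_ncard_ne_zero (show X.ncard ≠ 0 by omega)
      exact .star G _ none _ none (step c X hc hX (by omega)) (step _ _ hc' hX' (by omega))
        (hX.isStarProduct hG hc v₀)

/-- The following are equivalent: (i) every cubic, bipartite,
2-factor Hamiltonian graph is constructible from `K_{3,3}` and the Heawood graph via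
the star product; (ii) every cubic, 2-factor Hamiltonian brace is isomorphic to
`K_{3,3}` or to the Heawood graph. -/
theorem conjecture_equivalence :
    (∀ (V : Type) [Fintype V] (G : SimpleGraph V),
        IsCubic G → G.Colorable 2 → IsTwoFactorHamiltonian G → Constructible G) ↔
    (∀ (V : Type) [Fintype V] (G : SimpleGraph V),
        IsCubic G → IsBrace G → IsTwoFactorHamiltonian G →
        Nonempty (G ≃g completeBipartiteGraph (Fin 3) (Fin 3)) ∨
          Nonempty (G ≃g heawoodGraph)) := by
  constructor
  · intro hC V _ G hG hb hham
    cases hC V G hG hb.2.1 hham with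
    | k33 _ h => exact Or.inl h
    | heawood _ h => exact Or.inr h
    | star _ _ _ _ _ _ _ h => exact absurd h (hb.not_isStarProduct hG)
  · intro hB V _ G
    exact constructible_of_brace_classification hB _ V G rfl
end

section
/- Let G be a cubic, bipartite graph that can be represented as the star product (G1,v1)*(G2,v2) of two cubic, bipartite graphs G1 and G2. Then G is 2-factor Hamiltonian if and only if both G1 and G2 are 2-factor Hamiltonian. -/
open SimpleGraph

theorem isTwoFactorHamiltonian_iff_s6 {V : Type*} (G : SimpleGraph V) :
    IsTwoFactorHamiltonian G ↔
      ∀ K ≤ G, (∀ v, (K.neighborSet v).ncard = 2) → K.Connected := by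
  constructor
  · intro h K hK hd
    have := h (SimpleGraph.toSubgraph K hK) ⟨SimpleGraph.toSubgraph.isSpanning K hK, hd⟩
    rw [Subgraph.connected_iff', (Subgraph.spanningCoeEquivCoeOfSpanning _
      (SimpleGraph.toSubgraph.isSpanning K hK)).symm.connected_iff] at this
    exact this
  · intro h H hH
    rw [Subgraph.connected_iff', (Subgraph.spanningCoeEquivCoeOfSpanning _ hH.1).symm.connected_iff]
    exact h _ H.spanningCoe_le hH.2

/-- In a finite cubic graph every edge is used by some permutation moving each vertex to a
neighbour. -/
theorem IsCubic.exists_perm_adj {V : Type*} [Fintype V] {G : SimpleGraph V} (hG : IsCubic G)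
    {a b : V} (hab : G.Adj a b) :
    ∃ σ : Equiv.Perm V, (∀ v, G.Adj v (σ v)) ∧ σ a = b := by
  classical
  have hrow (v : V) : ∑ w, (if G.Adj v w then (1 / 3 : ℝ) else 0) = 1 := by
    have h3 := hG v
    rw [Set.ncard_eq_toFinset_card', ← SimpleGraph.neighborFinset_def,
      SimpleGraph.neighborFinset_eq_filter] at h3
    rw [← Finset.sum_filter, Finset.sum_const, h3]
    norm_num
  have hM : (Matrix.of fun v w ↦ if G.Adj v w then (1 / 3 : ℝ) else 0) ∈
      doublyStochastic ℝ V := by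
    rw [mem_doublyStochastic_iff_sum]
    refine ⟨fun v w ↦ ?_, hrow, fun w ↦ ?_⟩
    · simp only [Matrix.of_apply]
      split_ifs <;> norm_num
    · simpa only [Matrix.of_apply, G.adj_comm] using hrow w
  obtain ⟨w, hw, -, hsum⟩ := exists_eq_sum_perm_of_mem_doublyStochastic hM
  have happ (u v : V) : ∑ σ, (if σ u = v then w σ else 0) =
      if G.Adj u v then (1 / 3 : ℝ) else 0 := by
    have := congrFun (congrFun hsum u) v
    simpa [Matrix.sum_apply, Equiv.Perm.permMatrix, PEquiv.toMatrix_apply,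
      Equiv.toPEquiv_apply, eq_comm] using this
  have hpos : ∑ σ, (if σ a = b then w σ else 0) ≠ 0 := by
    rw [happ, if_pos hab]
    norm_num
  obtain ⟨σ, -, hσ⟩ := Finset.exists_ne_zero_of_sum_ne_zero hpos
  have hσ' : σ a = b ∧ w σ ≠ 0 := by simpa using hσ
  refine ⟨σ, fun v ↦ ?_, hσ'.1⟩
  by_contra hv
  have h0 := happ v (σ v)
  rw [if_neg hv, Finset.sum_eq_zero_iff_of_nonneg
    fun τ _ ↦ by split_ifs <;> simp [hw τ]] at h0
  exact hσ'.2 (by simpa using h0 σ (Finset.mem_univ σ))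

/-- A finite cubic bipartite graph has a 2-factor avoiding any given edge. -/
theorem IsCubic.exists_twoRegular_not_adj {V : Type*} [Fintype V] {G : SimpleGraph V}
    (hG : IsCubic G) (hb : G.Colorable 2) {a b : V} (hab : G.Adj a b) :
    ∃ K ≤ G, (∀ v, (K.neighborSet v).ncard = 2) ∧ ¬ K.Adj a b := by
  obtain ⟨C⟩ := hb
  have hC {u v w : V} (huv : C u ≠ C v) (hvw : C v ≠ C w) : C u = C w := by
    generalize C u = x at *
    generalize C v = y at *
    generalize C w = z at *
    revert x y z
    decide
  obtain ⟨σ, hσ, hσa⟩ := hG.exists_perm_adj hab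
  have hσ' (v : V) : G.Adj v (σ.symm v) := by simpa using (hσ (σ.symm v)).symm
  let K : SimpleGraph V :=
    { Adj := fun u v ↦ G.Adj u v ∧ ¬ ((C u = C a ∧ σ u = v) ∨ (C v = C a ∧ σ v = u))
      symm := ⟨fun u v h ↦ ⟨h.1.symm, by tauto⟩⟩
      loopless := ⟨fun u h ↦ G.loopless.irrefl u h.1⟩ }
  refine ⟨K, fun u v h ↦ h.1, fun v ↦ ?_, fun h ↦ h.2 (.inl ⟨rfl, hσa⟩)⟩
  obtain ⟨w, hw, hK⟩ : ∃ w, G.Adj v w ∧ K.neighborSet v = G.neighborSet v \ {w} := by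
    by_cases hv : C v = C a
    · refine ⟨σ v, hσ v, ?_⟩
      ext u
      simp only [mem_neighborSet, Set.mem_sdiff, Set.mem_singleton_iff]
      refine and_congr_right fun hu ↦ not_congr ⟨?_, fun h ↦ .inl ⟨hv, h.symm⟩⟩
      rintro (h | h)
      · exact h.2.symm
      · exact absurd (hv.trans h.1.symm) (C.valid hu)
    · refine ⟨σ.symm v, hσ' v, ?_⟩
      ext u
      simp only [mem_neighborSet, Set.mem_sdiff, Set.mem_singleton_iff]
      refine and_congr_right fun hu ↦ not_congr ⟨?_, fun h ↦ .inr ⟨?_, by simp [h]⟩⟩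
      · rintro (h | h)
        · exact absurd h.1 hv
        · exact (Equiv.eq_symm_apply σ).2 h.2
      · exact hC (C.valid hu.symm) hv
  rw [hK, Set.ncard_sdiff_singleton_of_mem (show w ∈ G.neighborSet v from hw), hG v]

/-- Double counting the edges of a properly 2-coloured finite graph. -/
theorem sum_ncard_neighborSet_color_eq {V : Type*} [Fintype V] {G : SimpleGraph V}
    (C : G.Coloring (Fin 2)) :
    ∑ v with C v = 0, (G.neighborSet v).ncard = ∑ v with C v = 1, (G.neighborSet v).ncard := by
  classical
  have h : G.IsBipartiteWith (↑({v | C v = 0} : Finset V)) (↑({v | C v = 1} : Finset V)) := by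
    refine ⟨?_, fun v w hvw ↦ ?_⟩
    · rw [Finset.disjoint_coe, Finset.disjoint_filter]
      intro v _ h0 h1
      simp [h0] at h1
    · have := C.valid hvw
      simp only [Finset.coe_filter, Finset.mem_univ, true_and, Set.mem_ofPred_eq]
      omega
  have := isBipartiteWith_sum_degrees_eq h
  simpa only [Set.ncard_eq_toFinset_card', ← SimpleGraph.neighborFinset_def,
    SimpleGraph.card_neighborFinset_eq_degree] using this

theorem IsCubic.ncard_neighborSet_eq_two {V : Type*} [Fintype V] {G K : SimpleGraph V}
    (hG : IsCubic G) (hb : G.Colorable 2) (hK : K ≤ G) {v : V}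
    (hd : ∀ u ≠ v, (K.neighborSet u).ncard = 2) : (K.neighborSet v).ncard = 2 := by
  classical
  obtain ⟨C⟩ := hb
  have hGs := sum_ncard_neighborSet_color_eq C
  have hKs := sum_ncard_neighborSet_color_eq (C.comp (Hom.ofLE hK))
  simp only [hG _, Finset.sum_const, smul_eq_mul] at hGs
  replace hGs : Finset.card {u | C u = 0} = Finset.card {u | C u = 1} := by omega
  obtain ⟨k, hk⟩ : ∃ k : ℤ, ((K.neighborSet v).ncard : ℤ) = 2 + k :=
    ⟨_, (add_sub_cancel 2 _).symm⟩
  have hKd (u : V) : ((K.neighborSet u).ncard : ℤ) =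
      2 + if u = v then k else 0 := by
    split_ifs with h
    · rw [h, hk]
    · rw [hd u h]; rfl
  have hKz := congrArg (Nat.cast : ℕ → ℤ) hKs
  push_cast at hKz
  simp only [hKd, Finset.sum_add_distrib, Finset.sum_const, Finset.sum_ite_eq',
    Finset.mem_filter, Finset.mem_univ, true_and] at hKz
  change Finset.card {u | C u = 0} • (2 : ℤ) + (if C v = 0 then _ else _) =
    Finset.card {u | C u = 1} • (2 : ℤ) + (if C v = 1 then _ else _) at hKz
  rw [hGs] at hKz
  have hv : C v = 0 ∨ C v = 1 := by omega
  rcases hv with hv | hv <;> simp [hv] at hKz <;> omega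

/-- Deleting a vertex from a finite connected 2-regular graph leaves it connected: a nonempty set
of other vertices that is closed under adjacency in the remaining graph contains all of them. -/
theorem mem_of_closed_of_connected_twoRegular {V : Type*} [Fintype V] {K : SimpleGraph V}
    (hc : K.Connected) (hd : ∀ v, (K.neighborSet v).ncard = 2) {v : V} {T : Set V}
    (hvT : v ∉ T) (hT : T.Nonempty) (hcl : ∀ x ∈ T, ∀ y ≠ v, K.Adj x y → y ∈ T)
    {x : V} (hx : x ≠ v) : x ∈ T := by
  classical
  have hclosed {S : Set V} (hS : ∀ x ∈ S, ∀ y, K.Adj x y → y ∈ S) {u w : V} (hu : u ∈ S) :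
      w ∈ S := by
    obtain ⟨p⟩ := hc u w
    induction p with
    | nil => exact hu
    | cons h _ ih => exact ih (hS _ hu _ h)
  obtain ⟨t, ht⟩ := hT
  obtain ⟨x₁, x₂, -, hN⟩ := Set.ncard_eq_two.1 (hd v)
  have hadj (y : V) : K.Adj v y ↔ y = x₁ ∨ y = x₂ := by
    simpa using Set.ext_iff.1 hN y
  let L : SimpleGraph V :=
    { Adj := fun a b ↦ K.Adj a b ∧ a ∈ T ∧ b ∈ T
      symm := ⟨fun a b h ↦ ⟨h.1.symm, h.2.2, h.2.1⟩⟩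
      loopless := ⟨fun a h ↦ K.loopless.irrefl a h.1⟩ }
  have hdeg (a : V) : L.degree a = if a ∈ T then if K.Adj v a then 1 else 2 else 0 := by
    rw [← SimpleGraph.card_neighborFinset_eq_degree, SimpleGraph.neighborFinset_def,
      ← Set.ncard_eq_toFinset_card']
    split_ifs with ha hva
    · have : L.neighborSet a = K.neighborSet a \ {v} := by
        ext b
        simp only [mem_neighborSet, Set.mem_sdiff, Set.mem_singleton_iff]
        exact ⟨fun h ↦ ⟨h.1, fun hb ↦ hvT (hb ▸ h.2.2)⟩, fun h ↦ ⟨h.1, ha, hcl a ha b h.2 h.1⟩⟩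
      rw [this, Set.ncard_sdiff_singleton_of_mem (show v ∈ K.neighborSet a from hva.symm), hd a]
    · have : L.neighborSet a = K.neighborSet a := by
        ext b
        simp only [mem_neighborSet]
        refine ⟨fun h ↦ h.1, fun h ↦ ⟨h, ha, hcl a ha b ?_ h⟩⟩
        rintro rfl
        exact hva h.symm
      rw [this, hd a]
    · have : L.neighborSet a = ∅ := by
        ext b
        simp only [mem_neighborSet, Set.mem_empty_iff_false, iff_false]
        exact fun h ↦ ha h.2.1
      rw [this, Set.ncard_empty]
  have hother {a : V} (haT : a ∈ T) (hva : K.Adj v a) : ∀ y, K.Adj v y → y ∈ T := by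
    obtain ⟨b, hba, hb⟩ := L.exists_ne_odd_degree_of_exists_odd_degree a
      (by rw [hdeg, if_pos haT, if_pos hva]; exact odd_one)
    have hb' : b ∈ T ∧ K.Adj v b := by
      rw [hdeg] at hb
      split_ifs at hb with h1 h2
      · exact ⟨h1, h2⟩
      · exact absurd hb (by decide)
      · exact absurd hb (by decide)
    intro y hy
    grind
  obtain ⟨a, haT, hva⟩ : ∃ a ∈ T, K.Adj v a := by
    by_contra! h
    refine hvT (hclosed (fun x hx y hxy ↦ hcl x hx y (fun hy ↦ h x hx (hy ▸ hxy.symm)) hxy) ht)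
  have : x ∈ insert v T := by
    refine hclosed (fun y hy z hyz ↦ ?_) (Set.mem_insert_of_mem v ht)
    by_cases hz : z = v
    · exact hz ▸ Set.mem_insert v T
    · refine Set.mem_insert_of_mem v ?_
      rcases hy with rfl | hy
      · exact hother haT hva z hyz
      · exact hcl y hy z hz hyz
  exact this.resolve_left hx

/-- A 2-regular spanning subgraph of a cubic graph omits at most one edge at each vertex. -/
theorem IsCubic.adj_of_ne {V : Type*} {G K : SimpleGraph V} (hG : IsCubic G) (hK : K ≤ G)
    (hd : ∀ u, (K.neighborSet u).ncard = 2) {v w z : V} (hw : G.Adj v w) (hwK : ¬ K.Adj v w)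
    (hz : G.Adj v z) (hzw : z ≠ w) : K.Adj v z := by
  have hfin : (G.neighborSet v).Finite := Set.finite_of_ncard_ne_zero (by rw [hG]; decide)
  have : K.neighborSet v = G.neighborSet v \ {w} := by
    refine Set.eq_of_subset_of_ncard_le (fun u hu ↦ ⟨hK hu, ?_⟩) ?_ hfin.sdiff
    · rintro rfl
      exact hwK hu
    · rw [Set.ncard_sdiff_singleton_of_mem (show w ∈ G.neighborSet v from hw), hG, hd]
  exact (Set.ext_iff.1 this z).2 ⟨hz, hzw⟩

/-- The two contraction maps of a star product `G = (G1,v1)*(G2,v2)`: `p` contracts the side of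
`G2` to `v1`, and `q` contracts the side of `G1` to `v2`. -/
structure IsStarContraction {V V1 V2 : Type*} (G : SimpleGraph V)
    (G1 : SimpleGraph V1) (v1 : V1) (G2 : SimpleGraph V2) (v2 : V2)
    (p : V → V1) (q : V → V2) : Prop where
  left_eq_iff : ∀ a, p a = v1 ↔ q a ≠ v2
  left_inj : ∀ a b, p a ≠ v1 → p a = p b → a = b
  right_inj : ∀ a b, q a ≠ v2 → q a = q b → a = b
  left_surj : Function.Surjective p
  right_surj : Function.Surjective q
  left_adj : ∀ x y, G1.Adj x y ↔ x ≠ y ∧ ∃ a b, G.Adj a b ∧ p a = x ∧ p b = y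
  right_adj : ∀ x y, G2.Adj x y ↔ x ≠ y ∧ ∃ a b, G.Adj a b ∧ q a = x ∧ q b = y
  left_cut : ∀ a b c, p a ≠ v1 → p b = v1 → p c = v1 → G.Adj a b → G.Adj a c → b = c
  right_cut : ∀ a b c, q a ≠ v2 → q b = v2 → q c = v2 → G.Adj a b → G.Adj a c → b = c

theorem IsStarProduct.exists_isStarContraction {V V1 V2 : Type*} {G : SimpleGraph V}
    {G1 : SimpleGraph V1} {v1 : V1} {G2 : SimpleGraph V2} {v2 : V2}
    (h : IsStarProduct G G1 v1 G2 v2) :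
    ∃ (p : V → V1) (q : V → V2), IsStarContraction G G1 v1 G2 v2 p q := by
  classical
  obtain ⟨f, g, m, h1, h2, hf, hg, hfg, hcov, ⟨hmaps, hminj, hmsurj⟩, hadj⟩ := h
  replace hf : ∀ x ≠ v1, ∀ y ≠ v1, f x = f y → x = y := fun x hx y hy hxy ↦ hf hx hy hxy
  replace hg : ∀ x ≠ v2, ∀ y ≠ v2, g x = g y → x = y := fun x hx y hy hxy ↦ hg hx hy hxy
  replace hmaps : ∀ x, G1.Adj v1 x → G2.Adj v2 (m x) := fun x hx ↦ hmaps hx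
  replace hminj : ∀ x y, G1.Adj v1 x → G1.Adj v1 y → m x = m y → x = y :=
    fun x y hx hy hxy ↦ hminj hx hy hxy
  replace hmsurj : ∀ y, G2.Adj v2 y → ∃ x, G1.Adj v1 x ∧ m x = y := fun y hy ↦ hmsurj hy
  have hn1 (x : V1) (hx : G1.Adj v1 x) : x ≠ v1 := hx.ne'
  have hn2 (y : V2) (hy : G2.Adj v2 y) : y ≠ v2 := hy.ne'
  obtain ⟨x₀, hx₀⟩ : ∃ x, G1.Adj v1 x := 
    Set.nonempty_of_ncard_ne_zero (s := G1.neighborSet v1) (by rw [h1]; decide)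
  obtain ⟨p, hpf, hpg⟩ : ∃ p : V → V1, (∀ x ≠ v1, p (f x) = x) ∧ ∀ y ≠ v2, p (g y) = v1 := by
    refine ⟨fun v ↦ if h : ∃ x, x ≠ v1 ∧ f x = v then h.choose else v1, fun x hx ↦ ?_,
      fun y hy ↦ dif_neg fun ⟨x, hx, hxy⟩ ↦ hfg x y hx hy hxy⟩
    have h : ∃ z, z ≠ v1 ∧ f z = f x := ⟨x, hx, rfl⟩
    refine (dif_pos h).trans ?_
    exact hf _ h.choose_spec.1 _ hx h.choose_spec.2
  obtain ⟨q, hqg, hqf⟩ : ∃ q : V → V2, (∀ y ≠ v2, q (g y) = y) ∧ ∀ x ≠ v1, q (f x) = v2 := by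
    refine ⟨fun v ↦ if h : ∃ y, y ≠ v2 ∧ g y = v then h.choose else v2, fun y hy ↦ ?_,
      fun x hx ↦ dif_neg fun ⟨y, hy, hxy⟩ ↦ hfg x y hx hy hxy.symm⟩
    have h : ∃ z, z ≠ v2 ∧ g z = g y := ⟨y, hy, rfl⟩
    refine (dif_pos h).trans ?_
    exact hg _ h.choose_spec.1 _ hy h.choose_spec.2
  have hcut (x : V1) (hx : G1.Adj v1 x) : G.Adj (f x) (g (m x)) :=
    (hadj _ _).2 (.inr (.inr ⟨x, hx, .inl ⟨rfl, rfl⟩⟩))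
  refine ⟨p, q, ?_, ?_, ?_, ?_, ?_, ?_, ?_, ?_, ?_⟩
  · intro a
    obtain ⟨x, hx, rfl⟩ | ⟨y, hy, rfl⟩ := hcov a
    · simp [hpf x hx, hqf x hx, hx]
    · simp [hpg y hy, hqg y hy, hy]
  · intro a b
    obtain ⟨x, hx, rfl⟩ | ⟨y, hy, rfl⟩ := hcov a <;>
      obtain ⟨x', hx', rfl⟩ | ⟨y', hy', rfl⟩ := hcov b <;> grind
  · intro a b
    obtain ⟨x, hx, rfl⟩ | ⟨y, hy, rfl⟩ := hcov a <;>
      obtain ⟨x', hx', rfl⟩ | ⟨y', hy', rfl⟩ := hcov b <;> grind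
  · intro x
    by_cases hx : x = v1
    · exact ⟨g (m x₀), (hpg _ (hn2 _ (hmaps _ hx₀))).trans hx.symm⟩
    · exact ⟨f x, hpf x hx⟩
  · intro y
    by_cases hy : y = v2
    · exact ⟨f x₀, (hqf _ (hn1 _ hx₀)).trans hy.symm⟩
    · exact ⟨g y, hqg y hy⟩
  · intro x y
    constructor
    · intro h
      refine ⟨h.ne, ?_⟩
      by_cases hx : x = v1
      · subst hx
        exact ⟨_, _, (hcut y h).symm, hpg _ (hn2 _ (hmaps _ h)), hpf _ h.ne'⟩
      · by_cases hy : y = v1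
        · subst hy
          exact ⟨_, _, hcut x h.symm, hpf _ hx, hpg _ (hn2 _ (hmaps _ h.symm))⟩
        · exact ⟨f x, f y, (hadj _ _).2 (.inl ⟨x, y, hx, hy, h, rfl, rfl⟩), hpf x hx, hpf y hy⟩
    · rintro ⟨hne, a, b, hab, rfl, rfl⟩
      obtain ⟨x, y, hx, hy, hxy, rfl, rfl⟩ | ⟨x, y, hx, hy, hxy, rfl, rfl⟩ |
        ⟨x, hx, ⟨rfl, rfl⟩ | ⟨rfl, rfl⟩⟩ := (hadj a b).1 hab
      · rwa [hpf x hx, hpf y hy]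
      · rw [hpg x hx, hpg y hy] at hne
        exact absurd rfl hne
      · rw [hpf x (hn1 x hx), hpg _ (hn2 _ (hmaps _ hx))]
        exact hx.symm
      · rwa [hpf x (hn1 x hx), hpg _ (hn2 _ (hmaps _ hx))]
  · intro x y
    constructor
    · intro h
      refine ⟨h.ne, ?_⟩
      by_cases hx : x = v2
      · subst hx
        obtain ⟨z, hz, rfl⟩ := hmsurj y h
        exact ⟨_, _, hcut z hz, hqf _ (hn1 _ hz), hqg _ h.ne'⟩
      · by_cases hy : y = v2
        · subst hy
          obtain ⟨z, hz, rfl⟩ := hmsurj x h.symm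
          exact ⟨_, _, (hcut z hz).symm, hqg _ hx, hqf _ (hn1 _ hz)⟩
        · exact ⟨g x, g y, (hadj _ _).2 (.inr (.inl ⟨x, y, hx, hy, h, rfl, rfl⟩)), hqg x hx,
            hqg y hy⟩
    · rintro ⟨hne, a, b, hab, rfl, rfl⟩
      obtain ⟨x, y, hx, hy, hxy, rfl, rfl⟩ | ⟨x, y, hx, hy, hxy, rfl, rfl⟩ |
        ⟨x, hx, ⟨rfl, rfl⟩ | ⟨rfl, rfl⟩⟩ := (hadj a b).1 hab
      · rw [hqf x hx, hqf y hy] at hne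
        exact absurd rfl hne
      · rwa [hqg x hx, hqg y hy]
      · rw [hqf x (hn1 x hx), hqg _ (hn2 _ (hmaps _ hx))]
        exact hmaps x hx
      · rw [hqf x (hn1 x hx), hqg _ (hn2 _ (hmaps _ hx))]
        exact (hmaps x hx).symm
  · intro a b c ha hb hc hab hac
    rw [hadj] at hab hac
    grind
  · intro a b c ha hb hc hab hac
    rw [hadj] at hab hac
    grind

namespace IsStarContraction

variable {V V1 V2 : Type*} {G : SimpleGraph V} {G1 : SimpleGraph V1} {v1 : V1}
  {G2 : SimpleGraph V2} {v2 : V2} {p : V → V1} {q : V → V2}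

theorem symm (h : IsStarContraction G G1 v1 G2 v2 p q) :
    IsStarContraction G G2 v2 G1 v1 q p where
  left_eq_iff a := by rw [Ne, h.left_eq_iff, not_not]
  left_inj := h.right_inj
  right_inj := h.left_inj
  left_surj := h.right_surj
  right_surj := h.left_surj
  left_adj := h.right_adj
  right_adj := h.left_adj
  left_cut := h.right_cut
  right_cut := h.left_cut

theorem injOn_neighborSet (h : IsStarContraction G G1 v1 G2 v2 p q) {a : V} (ha : p a ≠ v1) :
    Set.InjOn p (G.neighborSet a) := by
  intro b hb c hc hbc
  by_cases hb1 : p b = v1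
  · exact h.left_cut a b c ha hb1 (hbc ▸ hb1) hb hc
  · exact h.left_inj b c hb1 hbc

theorem left_ne_of_adj (h : IsStarContraction G G1 v1 G2 v2 p q) {a b : V} (ha : p a ≠ v1)
    (hab : G.Adj a b) : p a ≠ p b :=
  fun hp ↦ hab.ne (h.left_inj a b ha hp)

/-- The image of a spanning subgraph of a star product under the first contraction. -/
def leftImage (K : SimpleGraph V) (p : V → V1) : SimpleGraph V1 where
  Adj x y := x ≠ y ∧ ∃ a b, K.Adj a b ∧ p a = x ∧ p b = y
  symm := ⟨fun _ _ ⟨hne, a, b, hab, ha, hb⟩ ↦ ⟨hne.symm, b, a, hab.symm, hb, ha⟩⟩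
  loopless := ⟨fun _ h ↦ h.1 rfl⟩

theorem leftImage_le (h : IsStarContraction G G1 v1 G2 v2 p q) {K : SimpleGraph V} (hK : K ≤ G) :
    leftImage K p ≤ G1 :=
  fun x y ⟨hne, a, b, hab, ha, hb⟩ ↦ (h.left_adj x y).2 ⟨hne, a, b, hK hab, ha, hb⟩

theorem ncard_neighborSet_leftImage (h : IsStarContraction G G1 v1 G2 v2 p q)
    {K : SimpleGraph V} (hK : K ≤ G) {a : V} (ha : p a ≠ v1) :
    ((leftImage K p).neighborSet (p a)).ncard = (K.neighborSet a).ncard := by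
  have : (leftImage K p).neighborSet (p a) = p '' K.neighborSet a := by
    ext y
    constructor
    · rintro ⟨-, a', b, hab, ha', rfl⟩
      obtain rfl := h.left_inj a a' ha ha'.symm
      exact ⟨b, hab, rfl⟩
    · rintro ⟨b, hab, rfl⟩
      exact ⟨h.left_ne_of_adj ha (hK hab), a, b, hab, rfl, rfl⟩
  rw [this]
  exact Set.InjOn.ncard_image ((h.injOn_neighborSet ha).mono
    (show K.neighborSet a ⊆ _ from fun b hb ↦ hK hb))

theorem leftImage_twoRegular [Fintype V1] (h : IsStarContraction G G1 v1 G2 v2 p q)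
    (h1c : IsCubic G1) (h1b : G1.Colorable 2) {K : SimpleGraph V} (hK : K ≤ G)
    (hd : ∀ a, (K.neighborSet a).ncard = 2) (x : V1) :
    ((leftImage K p).neighborSet x).ncard = 2 := by
  have hne (x : V1) (hx : x ≠ v1) : ((leftImage K p).neighborSet x).ncard = 2 := by
    obtain ⟨a, rfl⟩ := h.left_surj x
    rw [h.ncard_neighborSet_leftImage hK hx, hd]
  by_cases hx : x = v1
  · exact hx ▸ h1c.ncard_neighborSet_eq_two h1b (h.leftImage_le hK) hne
  · exact hne x hx

theorem reachable_of_leftImage_connected [Fintype V1] (h : IsStarContraction G G1 v1 G2 v2 p q)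
    {K : SimpleGraph V} (hc : (leftImage K p).Connected)
    (hd : ∀ x, ((leftImage K p).neighborSet x).ncard = 2) {a b : V} (ha : p a ≠ v1)
    (hb : p b ≠ v1) : K.Reachable a b := by
  have hmem : p b ∈ {x | x ≠ v1 ∧ ∃ c, p c = x ∧ K.Reachable a c} := by
    refine mem_of_closed_of_connected_twoRegular hc hd (v := v1)
      (T := {x | x ≠ v1 ∧ ∃ c, p c = x ∧ K.Reachable a c}) (fun h ↦ h.1 rfl)
      ⟨p a, ha, a, rfl, .refl a⟩ ?_ hb
    rintro _ ⟨hx, c, rfl, hac⟩ y hy ⟨-, c', d, hcd, hc', rfl⟩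
    obtain rfl := h.left_inj c c' hx hc'.symm
    exact ⟨hy, d, rfl, hac.trans hcd.reachable⟩
  obtain ⟨-, c, hcb, hac⟩ := hmem
  exact h.left_inj b c hb hcb.symm ▸ hac

theorem isTwoFactorHamiltonian [Fintype V1] [Fintype V2]
    (h : IsStarContraction G G1 v1 G2 v2 p q)
    (h1c : IsCubic G1) (h1b : G1.Colorable 2) (h2c : IsCubic G2) (h2b : G2.Colorable 2)
    (h1 : IsTwoFactorHamiltonian G1) (h2 : IsTwoFactorHamiltonian G2) :
    IsTwoFactorHamiltonian G := by
  rw [isTwoFactorHamiltonian_iff_s6] at *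
  intro K hK hd
  have hd1 := h.leftImage_twoRegular h1c h1b hK hd
  have hd2 := h.symm.leftImage_twoRegular h2c h2b hK hd
  have hL {a b : V} (ha : p a ≠ v1) (hb : p b ≠ v1) : K.Reachable a b :=
    h.reachable_of_leftImage_connected (h1 _ (h.leftImage_le hK) hd1) hd1 ha hb
  have hR {a b : V} (ha : q a ≠ v2) (hb : q b ≠ v2) : K.Reachable a b :=
    h.symm.reachable_of_leftImage_connected (h2 _ (h.symm.leftImage_le hK) hd2) hd2 ha hb
  obtain ⟨x, hx, c, d, hcd, hc, rfl⟩ : ∃ x, (leftImage K p).Adj v1 x :=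
    Set.nonempty_of_ncard_ne_zero
      (s := (leftImage K p).neighborSet v1) (by rw [hd1]; decide)
  have hall (a : V) : K.Reachable a c := by
    by_cases ha : p a = v1
    · exact hR ((h.left_eq_iff a).1 ha) ((h.left_eq_iff c).1 hc)
    · exact (hL ha hx.symm).trans hcd.symm.reachable
  exact { preconnected := fun a b ↦ (hall a).trans (hall b).symm, nonempty := ⟨c⟩ }

/-- The common preimage, in a star product, of spanning subgraphs of the two factors. -/
def glue (G : SimpleGraph V) (p : V → V1) (q : V → V2) (K1 : SimpleGraph V1)
    (K2 : SimpleGraph V2) : SimpleGraph V where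
  Adj a b := G.Adj a b ∧ (p a ≠ p b → K1.Adj (p a) (p b)) ∧ (q a ≠ q b → K2.Adj (q a) (q b))
  symm := ⟨fun _ _ h ↦ ⟨h.1.symm, fun hne ↦ (h.2.1 hne.symm).symm,
    fun hne ↦ (h.2.2 hne.symm).symm⟩⟩
  loopless := ⟨fun a h ↦ G.loopless.irrefl a h.1⟩

theorem ncard_neighborSet_glue (h : IsStarContraction G G1 v1 G2 v2 p q)
    {K1 : SimpleGraph V1} {K2 : SimpleGraph V2} (hK1 : K1 ≤ G1)
    (hcut : ∀ a b, G.Adj a b → p a ≠ v1 → q b ≠ v2 → K1.Adj (p a) v1 → K2.Adj v2 (q b))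
    {a : V} (ha : p a ≠ v1) :
    ((glue G p q K1 K2).neighborSet a).ncard = (K1.neighborSet (p a)).ncard := by
  have hqa : q a = v2 := by_contra fun hq ↦ ha ((h.left_eq_iff a).2 hq)
  have : K1.neighborSet (p a) = p '' (glue G p q K1 K2).neighborSet a := by
    ext y
    constructor
    · intro hy
      obtain ⟨-, a', b, hab, ha', rfl⟩ := (h.left_adj _ _).1 (hK1 hy)
      obtain rfl := h.left_inj a a' ha ha'.symm
      refine ⟨b, ⟨hab, fun _ ↦ hy, fun hq ↦ ?_⟩, rfl⟩
      rw [hqa] at hq ⊢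
      refine hcut a b hab ha hq.symm ?_
      rw [← (h.left_eq_iff b).2 hq.symm]
      exact hy
    · rintro ⟨b, hab, rfl⟩
      exact hab.2.1 (h.left_ne_of_adj ha hab.1)
  rw [this]
  exact (Set.InjOn.ncard_image ((h.injOn_neighborSet ha).mono
    (show (glue G p q K1 K2).neighborSet a ⊆ _ from fun b hb ↦ hb.1))).symm

theorem left_isTwoFactorHamiltonian [Fintype V2] (h : IsStarContraction G G1 v1 G2 v2 p q)
    (h1c : IsCubic G1) (h2c : IsCubic G2) (h2b : G2.Colorable 2)
    (hG : IsTwoFactorHamiltonian G) : IsTwoFactorHamiltonian G1 := by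
  rw [isTwoFactorHamiltonian_iff_s6] at *
  intro K1 hK1 hd1
  obtain ⟨x, hx, hxK⟩ : ∃ x ∈ G1.neighborSet v1, x ∉ K1.neighborSet v1 :=
    Set.exists_mem_notMem_of_ncard_lt_ncard (by rw [hd1, h1c]; decide)
      (Set.finite_of_ncard_ne_zero (by rw [hd1]; decide))
  obtain ⟨hne, b₀, a₀, hba, hb₀, rfl⟩ := (h.left_adj _ _).1 hx
  have ha₀ : p a₀ ≠ v1 := hne.symm
  have hqa₀ : q a₀ = v2 := by_contra fun hq ↦ ha₀ ((h.left_eq_iff a₀).2 hq)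
  have hqb₀ : q b₀ ≠ v2 := (h.left_eq_iff b₀).1 hb₀
  have hy : G2.Adj v2 (q b₀) := (h.right_adj _ _).2 ⟨hqb₀.symm, a₀, b₀, hba.symm, hqa₀, rfl⟩
  obtain ⟨K2, hK2, hd2, hyK⟩ := h2c.exists_twoRegular_not_adj h2b hy
  have hcut1 (a b : V) (hab : G.Adj a b) (ha : p a ≠ v1) (hb : q b ≠ v2)
      (hK : K1.Adj (p a) v1) : K2.Adj v2 (q b) := by
    have hqa : q a = v2 := by_contra fun hq ↦ ha ((h.left_eq_iff a).2 hq)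
    refine h2c.adj_of_ne hK2 hd2 hy hyK
      ((h.right_adj _ _).2 ⟨hb.symm, a, b, hab, hqa, rfl⟩) fun hbb ↦ ?_
    obtain rfl := h.right_inj b b₀ hb hbb
    obtain rfl := h.right_cut b a a₀ hb hqa hqa₀ hab.symm hba
    exact hxK hK.symm
  have hcut2 (b a : V) (hab : G.Adj b a) (hb : q b ≠ v2) (ha : p a ≠ v1)
      (hK : K2.Adj (q b) v2) : K1.Adj v1 (p a) := by
    have hpb : p b = v1 := (h.left_eq_iff b).2 hb
    refine h1c.adj_of_ne hK1 hd1 hx hxK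
      ((h.left_adj _ _).2 ⟨ha.symm, b, a, hab, hpb, rfl⟩) fun haa ↦ ?_
    obtain rfl := h.left_inj a a₀ ha haa
    obtain rfl := h.left_cut a b b₀ ha hpb hb₀ hab.symm hba.symm
    exact hyK hK.symm
  have hcomm : glue G q p K2 K1 = glue G p q K1 K2 := by
    ext a b
    exact and_congr_right fun _ ↦ and_comm
  have hconn : (glue G p q K1 K2).Connected := by
    refine hG _ (fun a b hab ↦ hab.1) fun a ↦ ?_
    by_cases ha : p a = v1
    · rw [← hcomm, h.symm.ncard_neighborSet_glue hK2 hcut2 ((h.left_eq_iff a).1 ha), hd2]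
    · rw [h.ncard_neighborSet_glue hK1 hcut1 ha, hd1]
  have hreach {a b : V} (w : (glue G p q K1 K2).Walk a b) : K1.Reachable (p a) (p b) := by
    induction w with
    | nil => exact .refl _
    | @cons a b c hab _ ih =>
      by_cases hp : p a = p b
      · exact hp ▸ ih
      · exact (hab.2.1 hp).reachable.trans ih
  refine { preconnected := fun x y ↦ ?_, nonempty := ⟨v1⟩ }
  obtain ⟨a, rfl⟩ := h.left_surj x
  obtain ⟨b, rfl⟩ := h.left_surj y
  exact hreach (hconn a b).some

end IsStarContraction

/-- Let `G` be a cubic, bipartite graph that can be represented as the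
star product `(G1,v1)*(G2,v2)` of two cubic, bipartite graphs `G1` and `G2`. Then `G` is
2-factor Hamiltonian if and only if both `G1` and `G2` are 2-factor Hamiltonian. -/
theorem starProduct_twoFactorHamiltonian_iff {V V1 V2 : Type*}
    [Fintype V] [Fintype V1] [Fintype V2]
    (G : SimpleGraph V) (G1 : SimpleGraph V1) (v1 : V1) (G2 : SimpleGraph V2) (v2 : V2)
    (hGc : IsCubic G) (hGb : G.Colorable 2)
    (h1c : IsCubic G1) (h1b : G1.Colorable 2)
    (h2c : IsCubic G2) (h2b : G2.Colorable 2)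
    (hsp : IsStarProduct G G1 v1 G2 v2) :
    IsTwoFactorHamiltonian G ↔
      (IsTwoFactorHamiltonian G1 ∧ IsTwoFactorHamiltonian G2) := by
  obtain ⟨p, q, h⟩ := hsp.exists_isStarContraction
  exact ⟨fun hG ↦ ⟨h.left_isTwoFactorHamiltonian h1c h2c h2b hG,
    h.symm.left_isTwoFactorHamiltonian h2c h1c h1b hG⟩,
    fun ⟨h1, h2⟩ ↦ h.isTwoFactorHamiltonian h1c h1b h2c h2b h1 h2⟩
end

section
/- Let G = (G1,v1)*(G2,v2) be a cubic, bridgeless graph. Then G is 2-factor Hamiltonian if and only if both G1 and G2 are 2-factor Hamiltonian and the principal 3-edge cut of G is quasi-tight. -/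
open SimpleGraph

namespace SimpleGraph

section Cuts

variable {V : Type*}

/-- The darts of `H` that lead from `X` to its complement. -/
def cutDarts (H : SimpleGraph V) (X : Set V) : Set (V × V) :=
  {p | H.Adj p.1 p.2 ∧ p.1 ∈ X ∧ p.2 ∉ X}

theorem ncard_cutDarts_compl (H : SimpleGraph V) (X : Set V) :
    (H.cutDarts Xᶜ).ncard = (H.cutDarts X).ncard := by
  rw [← Set.ncard_image_of_injective (H.cutDarts X) Prod.swap_injective]
  congr 1
  ext ⟨a, b⟩
  simp [cutDarts, H.adj_comm a b]
  tauto

variable [Finite V]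

theorem ncard_darts_of_forall_ncard_neighborSet (H : SimpleGraph V) {d : ℕ} {X : Set V}
    (h : ∀ a ∈ X, (H.neighborSet a).ncard = d) :
    {p : V × V | H.Adj p.1 p.2 ∧ p.1 ∈ X}.ncard = d * X.ncard := by
  classical
  cases nonempty_fintype V
  rw [Set.ncard_eq_toFinset_card', Set.ncard_eq_toFinset_card', mul_comm]
  rw [Finset.card_eq_sum_card_fiberwise (f := Prod.fst) (t := X.toFinset)]
  · rw [← smul_eq_mul, ← Finset.sum_const]
    refine Finset.sum_congr rfl fun a ha => ?_
    rw [Set.mem_toFinset] at ha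
    rw [← h a ha, Set.ncard_eq_toFinset_card']
    refine Finset.card_bij (fun p _ => p.2) ?_ ?_ ?_
    · rintro ⟨x, y⟩ hp
      simp at hp ⊢
      grind
    · rintro ⟨x, y⟩ hp ⟨x', y'⟩ hp'
      simp at hp hp' ⊢
      grind
    · intro b hb
      exact ⟨(a, b), by simpa using ⟨by simpa using hb, ha⟩, rfl⟩
  · intro p hp
    simpa using (by simpa using hp : H.Adj p.1 p.2 ∧ p.1 ∈ X).2

theorem even_ncard_darts_inside (H : SimpleGraph V) (X : Set V) :
    Even {p : V × V | H.Adj p.1 p.2 ∧ p.1 ∈ X ∧ p.2 ∈ X}.ncard := by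
  classical
  cases nonempty_fintype V
  rw [Set.ncard_eq_toFinset_card', ← ZMod.natCast_eq_zero_iff_even, Finset.card_eq_sum_ones,
    Nat.cast_sum]
  refine Finset.sum_involution (fun p _ => p.swap) ?_ ?_ ?_ ?_
  · intros
    decide
  · rintro ⟨x, y⟩ hp - he
    simp at hp he
    exact H.ne_of_adj hp.1 he.1.symm
  · rintro ⟨x, y⟩ hp
    simp at hp ⊢
    exact ⟨hp.1.symm, hp.2.2, hp.2.1⟩
  · simp

/-- The number of darts leaving `X` has the same parity as the sum of the degrees in `X`. -/
theorem even_mul_ncard_add_ncard_cutDarts (H : SimpleGraph V) {d : ℕ} {X : Set V}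
    (h : ∀ a ∈ X, (H.neighborSet a).ncard = d) :
    Even (d * X.ncard + (H.cutDarts X).ncard) := by
  have hunion : {p : V × V | H.Adj p.1 p.2 ∧ p.1 ∈ X} =
      {p : V × V | H.Adj p.1 p.2 ∧ p.1 ∈ X ∧ p.2 ∈ X} ∪ H.cutDarts X := by
    ext p
    simp only [cutDarts, Set.mem_ofPred_eq, Set.mem_union]
    tauto
  have hdisj : Disjoint {p : V × V | H.Adj p.1 p.2 ∧ p.1 ∈ X ∧ p.2 ∈ X} (H.cutDarts X) :=
    Set.disjoint_left.2 fun p hp hp' => hp'.2.2 hp.2.2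
  rw [← ncard_darts_of_forall_ncard_neighborSet H h, hunion,
    Set.ncard_union_eq hdisj (Set.toFinite _) (Set.toFinite _), add_assoc]
  exact (even_ncard_darts_inside H X).add ⟨_, rfl⟩

end Cuts

section Closed

variable {V : Type*} {H : SimpleGraph V}

theorem Reachable.mem_of_closed {S : Set V} (hS : ∀ a b, H.Adj a b → a ∈ S → b ∈ S) {a b : V}
    (h : H.Reachable a b) (ha : a ∈ S) : b ∈ S := by
  obtain ⟨p⟩ := h
  induction p with
  | nil => exact ha
  | cons hadj _ ih => exact ih (hS _ _ hadj ha)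

theorem Connected.eq_univ_of_closed (h : H.Connected) {S : Set V} (hne : S.Nonempty)
    (hS : ∀ a b, H.Adj a b → a ∈ S → b ∈ S) : S = Set.univ := by
  obtain ⟨a, ha⟩ := hne
  exact Set.eq_univ_of_forall fun b => (h a b).mem_of_closed hS ha

theorem connected_of_forall_closed [Nonempty V]
    (h : ∀ S : Set V, S.Nonempty → (∀ a b, H.Adj a b → a ∈ S → b ∈ S) → S = Set.univ) :
    H.Connected := by
  refine connected_iff_exists_forall_reachable _ |>.2 ⟨Classical.arbitrary V, ?_⟩
  exact Set.eq_univ_iff_forall.1 <| h {b | H.Reachable (Classical.arbitrary V) b}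
    ⟨_, Reachable.refl _⟩ fun a b hab ha => Reachable.trans ha hab.reachable

/-- Deleting a vertex from a cycle leaves a connected graph. -/
theorem Connected.eq_empty_or_eq_of_closed_off [Finite V] (h : H.Connected)
    (hreg : ∀ v, (H.neighborSet v).ncard = 2) {v : V} {T : Set V} (hv : v ∉ T)
    (hT : ∀ a b, H.Adj a b → a ∈ T → b ≠ v → b ∈ T) : T = ∅ ∨ ∀ a, a ≠ v → a ∈ T := by
  have hcut : H.cutDarts T = (fun a => (a, v)) '' (H.neighborSet v ∩ T) := by
    ext ⟨a, b⟩
    simp only [cutDarts, Set.mem_ofPred_eq, Set.mem_image, Set.mem_inter_iff, mem_neighborSet,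
      Prod.mk.injEq]
    constructor
    · rintro ⟨hab, ha, hb⟩
      obtain rfl : b = v := by
        by_contra hbv
        exact hb (hT a b hab ha hbv)
      exact ⟨a, ⟨hab.symm, ha⟩, rfl, rfl⟩
    · rintro ⟨a, ⟨hva, ha⟩, rfl, rfl⟩
      exact ⟨hva.symm, ha, hv⟩
  have hpar := even_mul_ncard_add_ncard_cutDarts H (X := T) fun a _ => hreg a
  rw [hcut, Set.ncard_image_of_injective _ fun _ _ h => congrArg Prod.fst h] at hpar
  have hle : (H.neighborSet v ∩ T).ncard ≤ (H.neighborSet v).ncard :=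
    Set.ncard_le_ncard Set.inter_subset_left (Set.toFinite _)
  rw [hreg v] at hle
  obtain h0 | h2 : (H.neighborSet v ∩ T).ncard = 0 ∨ (H.neighborSet v ∩ T).ncard = 2 := by
    have := (Nat.even_add.1 hpar).1 (even_two_mul _)
    interval_cases (H.neighborSet v ∩ T).ncard <;> simp_all
  · left
    by_contra hne
    rw [Set.ncard_eq_zero (Set.toFinite _)] at h0
    have := h.eq_univ_of_closed (Set.nonempty_iff_ne_empty.2 hne) fun a b hab ha =>
      hT a b hab ha fun hbv => Set.eq_empty_iff_forall_notMem.1 h0 a ⟨(hbv ▸ hab).symm, ha⟩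
    exact hv (this ▸ Set.mem_univ v)
  · right
    have hsub : H.neighborSet v ⊆ T := by
      rw [← Set.inter_eq_left]
      exact Set.eq_of_subset_of_ncard_le Set.inter_subset_left (by rw [h2, hreg]) (Set.toFinite _)
    have := h.eq_univ_of_closed (S := insert v T) ⟨v, Set.mem_insert _ _⟩ fun a b hab ha => by
      rcases ha with rfl | ha
      · exact Or.inr (hsub hab)
      · exact or_iff_not_imp_left.2 fun hb => hT a b hab ha hb
    exact fun a ha => (Set.eq_univ_iff_forall.1 this a).resolve_left ha

end Closed

section PerfectMatching

variable {V : Type*} {G : SimpleGraph V}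

theorem exists_mem_cutDarts_ne (hb : ∀ e ∈ G.edgeSet, ¬ G.IsBridge e) {X : Set V} {p : V × V}
    (hp : p ∈ G.cutDarts X) : ∃ q ∈ G.cutDarts X, q ≠ p := by
  by_contra! hq
  obtain ⟨hadj, hp1, hp2⟩ := hp
  refine hb s(p.1, p.2) hadj (isBridge_iff.2 fun hr => hp2 ?_)
  refine hr.mem_of_closed (fun a b hab ha => ?_) hp1
  by_contra hbX
  rw [deleteEdges_adj] at hab
  have := hq (a, b) ⟨hab.1, ha, hbX⟩
  subst this
  exact hab.2 rfl

variable [Finite V]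

theorem three_le_ncard_cutDarts (hc : IsCubic G) (hb : ∀ e ∈ G.edgeSet, ¬ G.IsBridge e)
    {X : Set V} (hX : Odd X.ncard) : 3 ≤ (G.cutDarts X).ncard := by
  have hpar := even_mul_ncard_add_ncard_cutDarts G (X := X) fun a _ => hc a
  have hodd : Odd (G.cutDarts X).ncard := by
    have h3 : Odd (3 * X.ncard) := Odd.mul (by decide) hX
    rw [Nat.even_add] at hpar
    rw [← Nat.not_even_iff_odd] at *
    tauto
  have hne1 : (G.cutDarts X).ncard ≠ 1 := fun h1 => by
    obtain ⟨p, hp⟩ := Set.ncard_eq_one.1 h1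
    obtain ⟨q, hq, hne⟩ := exists_mem_cutDarts_ne (p := p) hb (X := X) (hp ▸ rfl)
    rw [hp] at hq
    exact hne hq
  obtain ⟨k, hk⟩ := hodd
  omega

/-- A set-theoretic form of the nontrivial direction of Tutte's theorem. -/
theorem exists_odd_sets_of_forall_not_isPerfectMatching
    (h : ∀ M : G.Subgraph, ¬ M.IsPerfectMatching) (hV : Even (Nat.card V)) :
    ∃ (S : Set V) (𝒞 : Set (Set V)), S.ncard + 2 ≤ 𝒞.ncard ∧ 𝒞.PairwiseDisjoint id ∧
      ∀ C ∈ 𝒞, Odd C.ncard ∧ Disjoint C S ∧ ∀ a b, G.Adj a b → a ∈ C → b ∉ S → b ∈ C := by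
  have ht := (not_iff_not.2 (tutte (G := G))).1 (not_exists.2 h)
  push Not at ht
  obtain ⟨S, hS⟩ := ht
  set K := ((⊤ : G.Subgraph).deleteVerts S).coe with hK
  have hinj : Function.Injective (fun c : K.ConnectedComponent => Subtype.val '' c.supp) :=
    fun c c' hcc => ConnectedComponent.supp_injective
      (Set.image_injective.2 Subtype.val_injective hcc)
  refine ⟨S, (fun c : K.ConnectedComponent => Subtype.val '' c.supp) '' K.oddComponents, ?_, ?_, ?_⟩
  · rw [Set.ncard_image_of_injective _ hinj]
    have hpar := odd_ncard_oddComponents (G := K)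
    have hcard : Nat.card ((⊤ : G.Subgraph).deleteVerts S).verts + S.ncard = Nat.card V := by
      rw [Nat.card_coe_set_eq]
      have := Set.ncard_compl_add_ncard S
      simpa [Set.compl_eq_univ_sdiff] using this
    have hlt : S.ncard < K.oddComponents.ncard := hS
    rw [← hcard, Nat.even_add] at hV
    rcases Nat.even_or_odd S.ncard with he | ho
    · have := Nat.not_odd_iff_even.1 (fun hh => Nat.not_even_iff_odd.2 (hpar.1 hh) (hV.2 he))
      obtain ⟨i, hi⟩ := he
      obtain ⟨j, hj⟩ := this
      omega
    · have := hpar.2 (Nat.not_even_iff_odd.1 fun hh => Nat.not_even_iff_odd.2 ho (hV.1 hh))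
      obtain ⟨i, hi⟩ := ho
      obtain ⟨j, hj⟩ := this
      omega
  · rintro _ ⟨c, hc, rfl⟩ _ ⟨c', hc', rfl⟩ hne
    refine Set.disjoint_left.2 ?_
    rintro _ ⟨x, hx, rfl⟩ ⟨y, hy, hxy⟩
    obtain rfl := Subtype.val_injective hxy
    refine hne ?_
    rw [ConnectedComponent.eq_of_common_vertex hx hy]
  · rintro _ ⟨c, hc, rfl⟩
    refine ⟨by rwa [Set.ncard_image_of_injective _ Subtype.val_injective], ?_, ?_⟩
    · refine Set.disjoint_left.2 ?_
      rintro _ ⟨x, hx, rfl⟩ hxS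
      exact x.2.2 hxS
    · rintro _ b hab ⟨x, hx, rfl⟩ hbS
      refine ⟨⟨b, trivial, hbS⟩, ?_, rfl⟩
      exact c.mem_supp_of_adj_mem_supp hx (by simpa [hK, hbS] using ⟨x.2.2, hab⟩)

/-- Every edge of a bridgeless cubic graph lies in a perfect matching. -/
theorem exists_perfect_matching_of_adj (hc : IsCubic G) (hb : ∀ e ∈ G.edgeSet, ¬ G.IsBridge e)
    {u v : V} (huv : G.Adj u v) :
    ∃ M : SimpleGraph V, M ≤ G ∧ (∀ a, (M.neighborSet a).ncard = 1) ∧ M.Adj u v := by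
  by_contra! hno
  set W : Set V := {u, v}ᶜ with hW
  have hnoW : ∀ M : (G.induce W).Subgraph, ¬ M.IsPerfectMatching := by
    intro M hM
    rw [Subgraph.isPerfectMatching_iff] at hM
    let N : SimpleGraph V :=
      { Adj := fun a b => (a = u ∧ b = v ∨ a = v ∧ b = u) ∨ ∃ x y : W, M.Adj x y ∧ x = a ∧ y = b
        symm := ⟨by
          rintro a b (h | ⟨x, y, hxy, hx, hy⟩)
          · exact Or.inl (by tauto)
          · exact Or.inr ⟨y, x, hxy.symm, hy, hx⟩⟩
        loopless := ⟨by
          rintro a ((⟨hu, hv⟩ | ⟨hv, hu⟩) | ⟨x, y, hxy, hx, hy⟩)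
          · exact huv.ne (hu.symm.trans hv)
          · exact huv.ne (hu.symm.trans hv)
          · exact hxy.ne (Subtype.val_injective (hx.trans hy.symm))⟩ }
    refine hno N ?_ (fun a => Set.ncard_eq_one.2 ?_) (Or.inl (Or.inl ⟨rfl, rfl⟩))
    · rintro a b ((⟨rfl, rfl⟩ | ⟨rfl, rfl⟩) | ⟨x, y, hxy, rfl, rfl⟩)
      · exact huv
      · exact huv.symm
      · exact hxy.adj_sub
    · by_cases ha : a ∈ W
      · obtain ⟨b, hab, hb⟩ := hM ⟨a, ha⟩
        refine ⟨b, Set.eq_singleton_iff_unique_mem.2 ⟨Or.inr ⟨_, _, hab, rfl, rfl⟩, ?_⟩⟩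
        rintro c ((⟨rfl, rfl⟩ | ⟨rfl, rfl⟩) | ⟨x, y, hxy, rfl, rfl⟩)
        · exact absurd (Or.inl rfl) ha
        · exact absurd (Or.inr rfl) ha
        · exact congrArg _ (hb y hxy)
      · obtain rfl | rfl : a = u ∨ a = v := not_not.1 ha
        · refine ⟨v, Set.eq_singleton_iff_unique_mem.2 ⟨Or.inl (Or.inl ⟨rfl, rfl⟩), ?_⟩⟩
          rintro c ((⟨-, h⟩ | ⟨h, -⟩) | ⟨x, y, -, hx, -⟩)
          · exact h
          · exact absurd h huv.ne
          · exact absurd (hx ▸ x.2) ha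
        · refine ⟨u, Set.eq_singleton_iff_unique_mem.2 ⟨Or.inl (Or.inr ⟨rfl, rfl⟩), ?_⟩⟩
          rintro c ((⟨h, -⟩ | ⟨-, h⟩) | ⟨x, y, -, hx, -⟩)
          · exact absurd h huv.ne'
          · exact h
          · exact absurd (hx ▸ x.2) ha
  have hV : Even (Nat.card V) := by
    have := even_mul_ncard_add_ncard_cutDarts G (X := Set.univ) fun a _ => hc a
    simp only [cutDarts, Set.mem_univ, not_true_eq_false, and_false] at this
    rw [Set.ncard_univ] at this
    simp at this
    rw [Nat.even_mul] at this
    exact this.resolve_left (by decide)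
  have hWcard : Even (Nat.card W) := by
    have h1 := Set.ncard_add_ncard_compl ({u, v} : Set V)
    rw [Set.ncard_pair huv.ne] at h1
    rw [← h1, Nat.even_add] at hV
    exact hV.1 even_two
  obtain ⟨S, 𝒞, hlt, hdisj, h𝒞⟩ := exists_odd_sets_of_forall_not_isPerfectMatching hnoW hWcard
  set T : Set V := {u, v} ∪ Subtype.val '' S with hT
  have hTcard : T.ncard = S.ncard + 2 := by
    rw [hT, Set.ncard_union_eq _ (Set.toFinite _) (Set.toFinite _), Set.ncard_pair huv.ne,
      Set.ncard_image_of_injective _ Subtype.val_injective, add_comm]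
    refine Set.disjoint_left.2 ?_
    rintro _ hx ⟨x, -, rfl⟩
    exact x.2 hx
  let D : Set W → Set (V × V) := fun C => G.cutDarts (Subtype.val '' C)
  have hD3 : 3 * 𝒞.ncard ≤ (⋃ C ∈ 𝒞, D C).ncard := by
    classical
    have hfin : 𝒞.Finite := Set.toFinite _
    have hDfin (C : Set W) : (D C).Finite := Set.toFinite _
    have hun : (⋃ C ∈ 𝒞, D C) = ↑(hfin.toFinset.biUnion fun C => (hDfin C).toFinset) := by
      ext p
      simp
    rw [hun, Set.ncard_coe_finset, Finset.card_biUnion, Set.ncard_eq_toFinset_card _ hfin,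
      mul_comm, ← smul_eq_mul]
    · refine Finset.card_nsmul_le_sum _ _ _ fun C hC => ?_
      rw [← Set.ncard_eq_toFinset_card]
      refine three_le_ncard_cutDarts hc hb ?_
      rw [Set.ncard_image_of_injective _ Subtype.val_injective]
      exact (h𝒞 C (hfin.mem_toFinset.1 hC)).1
    · intro C hC C' hC' hne
      refine Finset.disjoint_left.2 fun p hp hp' => ?_
      rw [Set.Finite.mem_toFinset] at hp hp'
      obtain ⟨-, ⟨x, hx, hxp⟩, -⟩ := hp
      obtain ⟨-, ⟨y, hy, hyp⟩, -⟩ := hp'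
      obtain rfl := Subtype.val_injective (hxp.trans hyp.symm)
      exact Set.disjoint_left.1 (hdisj (hfin.mem_toFinset.1 hC) (hfin.mem_toFinset.1 hC') hne)
        hx hy
  have hsub : Prod.swap '' (⋃ C ∈ 𝒞, D C) ⊆
      {p : V × V | G.Adj p.1 p.2 ∧ p.1 ∈ T} \ {(u, v), (v, u)} := by
    rintro _ ⟨⟨a, b⟩, hp, rfl⟩
    simp only [Set.mem_iUnion] at hp
    obtain ⟨C, hC, hadj, ⟨x, hx, rfl⟩, hb⟩ := hp
    obtain ⟨-, hCS, hcl⟩ := h𝒞 C hC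
    refine ⟨⟨hadj.symm, ?_⟩, ?_⟩
    · by_contra hbT
      have hbW : b ∈ W := fun h => hbT (Or.inl h)
      exact hb ⟨⟨b, hbW⟩, hcl x ⟨b, hbW⟩ hadj hx fun h => hbT (Or.inr ⟨_, h, rfl⟩), rfl⟩
    · intro h
      refine x.2 ?_
      simp at h ⊢
      tauto
  have hle := Set.ncard_le_ncard hsub (Set.toFinite _)
  rw [Set.ncard_image_of_injective _ Prod.swap_injective] at hle
  have hpair : ({(u, v), (v, u)} : Set (V × V)).ncard = 2 :=
    Set.ncard_pair fun h => huv.ne (congrArg Prod.fst h)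
  have hadd := Set.ncard_sdiff_add_ncard_of_subset (s := {(u, v), (v, u)})
    (t := {p : V × V | G.Adj p.1 p.2 ∧ p.1 ∈ T}) (by
      rintro _ (rfl | rfl)
      · exact ⟨huv, Or.inl (Or.inl rfl)⟩
      · exact ⟨huv.symm, Or.inl (Or.inr rfl)⟩) (Set.toFinite _)
  rw [ncard_darts_of_forall_ncard_neighborSet G fun a _ => hc a] at hadd
  omega

end PerfectMatching

section Factors

variable {V : Type*} {G : SimpleGraph V}

theorem ncard_neighborSet_sdiff [Finite V] {K : SimpleGraph V} (h : K ≤ G) (v : V) :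
    ((G \ K).neighborSet v).ncard = (G.neighborSet v).ncard - (K.neighborSet v).ncard := by
  have hsub : K.neighborSet v ⊆ G.neighborSet v := fun _ hw => h hw
  rw [← Set.ncard_sdiff hsub (Set.toFinite _)]
  rfl

theorem isTwoFactorHamiltonian_iff : IsTwoFactorHamiltonian G ↔
    ∀ H ≤ G, (∀ v, (H.neighborSet v).ncard = 2) → H.Connected := by
  constructor
  · intro h H hH hreg
    have := (h (toSubgraph H hH) ⟨toSubgraph.isSpanning H hH, hreg⟩).coe
    rwa [← ((toSubgraph H hH).spanningCoeEquivCoeOfSpanning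
      (toSubgraph.isSpanning H hH)).connected_iff] at this
  · intro h H hH
    refine ⟨(H.spanningCoeEquivCoeOfSpanning hH.1).connected_iff.1 ?_⟩
    exact h _ H.spanningCoe_le hH.2

theorem Subgraph.isPerfectMatching_iff_ncard {M : G.Subgraph} :
    M.IsPerfectMatching ↔ ∀ v, (M.spanningCoe.neighborSet v).ncard = 1 := by
  rw [Subgraph.isPerfectMatching_iff]
  refine forall_congr' fun v => ?_
  rw [Set.ncard_eq_one]
  exact exists_congr fun w => Set.eq_singleton_iff_unique_mem.symm

theorem injOn_sym2_mk_cutDarts (X : Set V) :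
    Set.InjOn (fun p : V × V => s(p.1, p.2)) (G.cutDarts X) := by
  rintro ⟨a, b⟩ ⟨-, ha, hb⟩ ⟨a', b'⟩ ⟨-, ha', hb'⟩ h
  rcases Sym2.eq_iff.1 h with ⟨rfl, rfl⟩ | ⟨rfl, rfl⟩
  · rfl
  · exact absurd ha' hb

end Factors

section Contraction

variable {V W : Type*}

/-- The image of `H` under `c`, without loops. -/
def contract (H : SimpleGraph V) (c : V → W) : SimpleGraph W where
  Adj x y := x ≠ y ∧ ∃ a b, c a = x ∧ c b = y ∧ H.Adj a b
  symm := ⟨fun _ _ ⟨hne, a, b, ha, hb, hab⟩ => ⟨hne.symm, b, a, hb, ha, hab.symm⟩⟩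
  loopless := ⟨fun _ h => h.1 rfl⟩

/-- `c` contracts the complement of `X` to the vertex `w` of `G'`, and at most one of the contracted
edges is incident with each vertex of `X`. -/
structure IsContraction (G : SimpleGraph V) (G' : SimpleGraph W) (w : W) (X : Set V)
    (c : V → W) : Prop where
  mem_iff : ∀ a, a ∈ X ↔ c a ≠ w
  injOn : Set.InjOn c X
  surjective : Function.Surjective c
  map_adj : ∀ a b, G.Adj a b → c a ≠ c b → G'.Adj (c a) (c b)
  exists_adj : ∀ x y, G'.Adj x y → ∃ a b, c a = x ∧ c b = y ∧ G.Adj a b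
  eq_of_adj : ∀ a b b', a ∈ X → b ∉ X → b' ∉ X → G.Adj a b → G.Adj a b' → b = b'

namespace IsContraction

variable {G H : SimpleGraph V} {G' : SimpleGraph W} {w : W} {X : Set V} {c : V → W}

theorem map_eq (hc : IsContraction G G' w X c) {b : V} (hb : b ∉ X) : c b = w :=
  not_not.1 fun h => hb ((hc.mem_iff b).2 h)

theorem contract_le (hc : IsContraction G G' w X c) (hH : H ≤ G) : H.contract c ≤ G' := by
  rintro _ _ ⟨hne, a, b, rfl, rfl, hab⟩
  exact hc.map_adj a b (hH hab) hne

theorem contract_adj (hc : IsContraction G G' w X c) {a b : V} (ha : a ∈ X) (hab : H.Adj a b) :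
    (H.contract c).Adj (c a) (c b) := by
  refine ⟨fun h => ?_, a, b, rfl, rfl, hab⟩
  have hb : b ∈ X := (hc.mem_iff b).2 (h ▸ (hc.mem_iff a).1 ha)
  exact hab.ne (hc.injOn ha hb h)

theorem neighborSet_contract (hc : IsContraction G G' w X c) {a : V} (ha : a ∈ X) :
    (H.contract c).neighborSet (c a) = c '' H.neighborSet a := by
  ext y
  constructor
  · rintro ⟨-, a', b, ha', rfl, hab⟩
    have : a' ∈ X := (hc.mem_iff a').2 (ha' ▸ (hc.mem_iff a).1 ha)
    obtain rfl := hc.injOn this ha ha'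
    exact ⟨b, hab, rfl⟩
  · rintro ⟨b, hab, rfl⟩
    exact hc.contract_adj ha hab

theorem ncard_neighborSet_contract (hc : IsContraction G G' w X c) (hH : H ≤ G) {a : V}
    (ha : a ∈ X) : ((H.contract c).neighborSet (c a)).ncard = (H.neighborSet a).ncard := by
  rw [hc.neighborSet_contract ha, Set.InjOn.ncard_image]
  intro b hb b' hb' h
  by_cases hbX : b ∈ X
  · exact hc.injOn hbX ((hc.mem_iff b').2 (h ▸ (hc.mem_iff b).1 hbX)) h
  · have hbX' : b' ∉ X := fun h' => (hc.mem_iff b').1 h' (h ▸ hc.map_eq hbX)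
    exact hc.eq_of_adj a b b' ha hbX hbX' (hH hb) (hH hb')

theorem neighborSet_contract_self (hc : IsContraction G G' w X c) :
    (H.contract c).neighborSet w = (fun p => c p.1) '' H.cutDarts X := by
  ext y
  constructor
  · rintro ⟨hne, b, a, rfl, rfl, hba⟩
    exact ⟨(a, b), ⟨hba.symm, (hc.mem_iff a).2 hne.symm, fun h => (hc.mem_iff b).1 h rfl⟩, rfl⟩
  · rintro ⟨⟨a, b⟩, ⟨hab, ha, hb⟩, rfl⟩
    have := hc.contract_adj ha hab
    rw [hc.map_eq hb] at this
    exact this.symm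

theorem ncard_neighborSet_contract_self (hc : IsContraction G G' w X c) (hH : H ≤ G) :
    ((H.contract c).neighborSet w).ncard = (H.cutDarts X).ncard := by
  rw [hc.neighborSet_contract_self, Set.InjOn.ncard_image]
  rintro ⟨a, b⟩ ⟨hab, ha, hb⟩ ⟨a', b'⟩ ⟨hab', ha', hb'⟩ h
  obtain rfl := hc.injOn ha ha' h
  obtain rfl := hc.eq_of_adj a b b' ha hb hb' (hH hab) (hH hab')
  rfl

theorem contract_eq (hc : IsContraction G G' w X c) : G.contract c = G' := by
  refine le_antisymm (hc.contract_le le_rfl) fun x y h => ?_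
  exact ⟨h.ne, hc.exists_adj x y h⟩

theorem ncard_cutDarts (hc : IsContraction G G' w X c) :
    (G.cutDarts X).ncard = (G'.neighborSet w).ncard := by
  rw [← hc.ncard_neighborSet_contract_self le_rfl, hc.contract_eq]

theorem connected_contract (hc : IsContraction G G' w X c) (h : H.Connected) :
    (H.contract c).Connected := by
  have : Nonempty W := ⟨w⟩
  refine connected_of_forall_closed fun S hS hcl => ?_
  obtain ⟨x, hx⟩ := hS
  obtain ⟨a, rfl⟩ := hc.surjective x
  have := h.eq_univ_of_closed (S := c ⁻¹' S) ⟨a, hx⟩ fun a b hab ha => by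
    by_cases heq : c a = c b
    · exact (show c b ∈ S from heq ▸ ha)
    · exact hcl _ _ ⟨heq, a, b, rfl, rfl, hab⟩ ha
  refine Set.eq_univ_of_forall fun y => ?_
  obtain ⟨b, rfl⟩ := hc.surjective y
  exact Set.eq_univ_iff_forall.1 this b

/-- If the contraction of a 2-factor is a Hamiltonian cycle, then a union of components of the
2-factor contains all of `X` or none of it. -/
theorem inter_eq_empty_or_subset [Finite V] [Finite W] (hc : IsContraction G G' w X c)
    (hconn : (H.contract c).Connected)
    (hreg : ∀ x, ((H.contract c).neighborSet x).ncard = 2) {S : Set V}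
    (hS : ∀ a b, H.Adj a b → a ∈ S → b ∈ S) : S ∩ X = ∅ ∨ X ⊆ S := by
  have := hconn.eq_empty_or_eq_of_closed_off hreg (v := w) (T := c '' (S ∩ X)) ?_ ?_
  · refine this.imp Set.image_eq_empty.1 fun h a ha => ?_
    obtain ⟨b, hb, hba⟩ := h (c a) ((hc.mem_iff a).1 ha)
    obtain rfl := hc.injOn hb.2 ha hba
    exact hb.1
  · rintro ⟨a, ha, haw⟩
    exact (hc.mem_iff a).1 ha.2 haw
  · rintro _ _ ⟨hne, a, b, rfl, rfl, hab⟩ ⟨a', ha', heq⟩ hbw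
    have ha : a ∈ X := (hc.mem_iff a).2 (heq ▸ (hc.mem_iff a').1 ha'.2)
    obtain rfl := hc.injOn ha'.2 ha heq
    exact ⟨b, ⟨hS _ _ hab ha'.1, (hc.mem_iff b).2 hbw⟩, rfl⟩

/-- Glue a subgraph of the contraction to the part of `K` outside of `X`. -/
def glue (G : SimpleGraph V) (X : Set V) (c : V → W) (H' : SimpleGraph W) (K : SimpleGraph V) :
    SimpleGraph V where
  Adj a b := G.Adj a b ∧ ((a ∈ X ∨ b ∈ X) ∧ H'.Adj (c a) (c b) ∨ a ∉ X ∧ b ∉ X ∧ K.Adj a b)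
  symm := ⟨fun a b h => by
    rw [G.adj_comm, H'.adj_comm, K.adj_comm]
    tauto⟩
  loopless := ⟨fun _ h => h.1.ne rfl⟩

theorem glue_le (H' : SimpleGraph W) (K : SimpleGraph V) : glue G X c H' K ≤ G :=
  fun _ _ h => h.1

theorem contract_glue (hc : IsContraction G G' w X c) {H' : SimpleGraph W} (hH' : H' ≤ G')
    (K : SimpleGraph V) : (glue G X c H' K).contract c = H' := by
  ext x y
  constructor
  · rintro ⟨hne, a, b, rfl, rfl, -, ⟨-, h⟩ | ⟨ha, hb, -⟩⟩
    · exact h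
    · exact absurd ((hc.map_eq ha).trans (hc.map_eq hb).symm) hne
  · intro h
    obtain ⟨a, b, rfl, rfl, hab⟩ := hc.exists_adj x y (hH' h)
    refine ⟨h.ne, a, b, rfl, rfl, hab, Or.inl ⟨?_, h⟩⟩
    by_contra! hX
    exact h.ne ((hc.map_eq hX.1).trans (hc.map_eq hX.2).symm)

theorem neighborSet_glue {H' : SimpleGraph W} {K : SimpleGraph V} (hK : K ≤ G)
    (hagree : ∀ a b, G.Adj a b → a ∈ X → b ∉ X → (H'.Adj (c a) (c b) ↔ K.Adj a b)) {a : V}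
    (ha : a ∉ X) : (glue G X c H' K).neighborSet a = K.neighborSet a := by
  ext b
  simp only [mem_neighborSet, glue]
  constructor
  · rintro ⟨hab, ⟨hX, h⟩ | ⟨-, -, h⟩⟩
    · exact ((hagree b a hab.symm (hX.resolve_left ha) ha).1 h.symm).symm
    · exact h
  · intro h
    refine ⟨hK h, ?_⟩
    by_cases hb : b ∈ X
    · exact Or.inl ⟨Or.inr hb, ((hagree b a (hK h).symm hb ha).2 h.symm).symm⟩
    · exact Or.inr ⟨ha, hb, h⟩

variable [Finite V]

theorem ncard_cutDarts_sdiff {K : SimpleGraph V} (hK : K ≤ G) (Y : Set V) :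
    ((G \ K).cutDarts Y).ncard = (G.cutDarts Y).ncard - (K.cutDarts Y).ncard := by
  have hsub : K.cutDarts Y ⊆ G.cutDarts Y := fun _ hp => ⟨hK hp.1, hp.2⟩
  rw [← Set.ncard_sdiff hsub (Set.toFinite _)]
  congr 1
  ext p
  simp only [cutDarts, sdiff_adj, Set.mem_ofPred_eq, Set.mem_sdiff]
  tauto

theorem ncard_cutDarts_eq_one (hc : IsContraction G G' w X c) (hGc : IsCubic G)
    (hw : (G'.neighborSet w).ncard = 3)
    (hG : ∀ H ≤ G, (∀ v, (H.neighborSet v).ncard = 2) → H.Connected)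
    {M : SimpleGraph V} (hM : M ≤ G) (hM1 : ∀ v, (M.neighborSet v).ncard = 1) :
    (M.cutDarts X).ncard = 1 := by
  have hcut : (G.cutDarts X).ncard = 3 := hc.ncard_cutDarts.trans hw
  have hparG := even_mul_ncard_add_ncard_cutDarts G (X := X) fun a _ => hGc a
  have hparM := even_mul_ncard_add_ncard_cutDarts M (X := X) fun a _ => hM1 a
  have hle : (M.cutDarts X).ncard ≤ 3 :=
    hcut ▸ Set.ncard_le_ncard (fun _ hp => ⟨hM hp.1, hp.2⟩) (Set.toFinite _)
  have hne : (M.cutDarts X).ncard ≠ 3 := by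
    intro h3
    have hzero := ncard_cutDarts_sdiff hM X
    rw [hcut, h3, Nat.sub_self, Set.ncard_eq_zero (Set.toFinite _)] at hzero
    obtain ⟨p, hp⟩ : (G.cutDarts X).Nonempty := Set.nonempty_of_ncard_ne_zero (by omega)
    have hconn := hG (G \ M) sdiff_le fun v => by rw [ncard_neighborSet_sdiff hM, hGc, hM1]
    have := hconn.eq_univ_of_closed (S := X) ⟨p.1, hp.2.1⟩ fun a b hab ha => by
      by_contra hb
      exact Set.eq_empty_iff_forall_notMem.1 hzero (a, b) ⟨hab, ha, hb⟩
    exact hp.2.2 (this ▸ Set.mem_univ _)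
  rw [hcut] at hparG
  obtain ⟨i, hi⟩ := hparG
  obtain ⟨j, hj⟩ := hparM
  omega

theorem connected_of_isTwoFactorHamiltonian [Finite W] (hc : IsContraction G G' w X c)
    (hGc : IsCubic G) (hb : ∀ e ∈ G.edgeSet, ¬ G.IsBridge e) (hw : (G'.neighborSet w).ncard = 3)
    (hG : ∀ H ≤ G, (∀ v, (H.neighborSet v).ncard = 2) → H.Connected)
    {H' : SimpleGraph W} (hH' : H' ≤ G') (hreg : ∀ x, (H'.neighborSet x).ncard = 2) :
    H'.Connected := by
  have hsub : H'.neighborSet w ⊆ G'.neighborSet w := fun _ hx => hH' hx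
  have hone : (G'.neighborSet w \ H'.neighborSet w).ncard = 1 := by
    rw [Set.ncard_sdiff hsub (Set.toFinite _), hw, hreg]
  obtain ⟨x, hx⟩ := Set.ncard_eq_one.1 hone
  have hxadj : x ∈ G'.neighborSet w \ H'.neighborSet w := hx ▸ rfl
  obtain ⟨b, a, rfl, rfl, hba⟩ := hc.exists_adj w x hxadj.1
  have hbX : b ∉ X := fun h => (hc.mem_iff b).1 h rfl
  have haX : a ∈ X := (hc.mem_iff a).2 hxadj.1.ne'
  obtain ⟨M, hM, hM1, hMab⟩ := exists_perfect_matching_of_adj hGc hb hba.symm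
  obtain ⟨p, hp⟩ := Set.ncard_eq_one.1 (hc.ncard_cutDarts_eq_one hGc hw hG hM hM1)
  have hpab : (a, b) ∈ M.cutDarts X := ⟨hMab, haX, hbX⟩
  have hagree : ∀ a' b', G.Adj a' b' → a' ∈ X → b' ∉ X →
      (H'.Adj (c a') (c b') ↔ (G \ M).Adj a' b') := by
    intro a' b' hab' ha' hb'
    rw [hc.map_eq hb', ← hc.map_eq hbX, sdiff_adj, H'.adj_comm]
    have hG' : G'.Adj (c b) (c a') := by
      have := hc.map_adj a' b' hab' (hc.map_eq hb' ▸ (hc.mem_iff a').1 ha')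
      rw [hc.map_eq hb', ← hc.map_eq hbX] at this
      exact this.symm
    constructor
    · refine fun h => ⟨hab', fun hMab' => ?_⟩
      have : (a', b') ∈ M.cutDarts X := ⟨hMab', ha', hb'⟩
      rw [hp] at this hpab
      obtain ⟨rfl, rfl⟩ := Prod.ext_iff.1 (this.trans hpab.symm)
      exact hxadj.2 h
    · rintro ⟨-, h⟩
      by_contra hno
      have : c a' = c a := (hx ▸ ⟨hG', hno⟩ : c a' ∈ ({c a} : Set W))
      obtain rfl := hc.injOn ha' haX this
      obtain rfl := hc.eq_of_adj a' b b' haX hbX hb' hba.symm hab'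
      exact h hMab
  have hglue : ∀ v, ((glue G X c H' (G \ M)).neighborSet v).ncard = 2 := by
    intro v
    by_cases hv : v ∈ X
    · rw [← hc.ncard_neighborSet_contract (glue_le _ _) hv, hc.contract_glue hH', hreg]
    · rw [neighborSet_glue sdiff_le hagree hv, ncard_neighborSet_sdiff hM, hGc, hM1]
  rw [← hc.contract_glue hH' (G \ M)]
  exact hc.connected_contract (hG _ (glue_le _ _) hglue)

theorem connected_of_contractions {W₂ : Type*} [Finite W] [Finite W₂] {G₂ : SimpleGraph W₂}
    {w₂ : W₂} {c₂ : V → W₂} (hc : IsContraction G G' w X c) (hc₂ : IsContraction G G₂ w₂ Xᶜ c₂)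
    (hGc : IsCubic G) (hw : (G'.neighborSet w).ncard = 3)
    (hG' : ∀ H ≤ G', (∀ v, (H.neighborSet v).ncard = 2) → H.Connected)
    (hG₂ : ∀ H ≤ G₂, (∀ v, (H.neighborSet v).ncard = 2) → H.Connected)
    (hM : ∀ M ≤ G, (∀ v, (M.neighborSet v).ncard = 1) → (M.cutDarts X).ncard = 1)
    (hH : H ≤ G) (hreg : ∀ v, (H.neighborSet v).ncard = 2) : H.Connected := by
  have hcutM := hM (G \ H) sdiff_le fun v => by rw [ncard_neighborSet_sdiff hH, hGc, hreg]
  rw [ncard_cutDarts_sdiff hH, hc.ncard_cutDarts.trans hw] at hcutM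
  have hcut : (H.cutDarts X).ncard = 2 := by omega
  have hreg' : ∀ x, ((H.contract c).neighborSet x).ncard = 2 := by
    intro x
    by_cases hx : x = w
    · rw [hx, hc.ncard_neighborSet_contract_self hH, hcut]
    · obtain ⟨a, rfl⟩ := hc.surjective x
      rw [hc.ncard_neighborSet_contract hH ((hc.mem_iff a).2 hx), hreg]
  have hreg₂ : ∀ x, ((H.contract c₂).neighborSet x).ncard = 2 := by
    intro x
    by_cases hx : x = w₂
    · rw [hx, hc₂.ncard_neighborSet_contract_self hH, ncard_cutDarts_compl, hcut]
    · obtain ⟨a, rfl⟩ := hc₂.surjective x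
      rw [hc₂.ncard_neighborSet_contract hH ((hc₂.mem_iff a).2 hx), hreg]
  obtain ⟨⟨a, b⟩, hab, ha, hb⟩ : (H.cutDarts X).Nonempty :=
    Set.nonempty_of_ncard_ne_zero (by omega)
  have : Nonempty V := ⟨a⟩
  refine connected_of_forall_closed fun S hne hS => ?_
  have h₁ := hc.inter_eq_empty_or_subset (hG' _ (hc.contract_le hH) hreg') hreg' hS
  have h₂ := hc₂.inter_eq_empty_or_subset (hG₂ _ (hc₂.contract_le hH) hreg₂) hreg₂ hS
  have hSab : a ∈ S ↔ b ∈ S := ⟨hS a b hab, hS b a hab.symm⟩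
  rw [← Set.univ_subset_iff, ← Set.union_compl_self X]
  rcases h₁ with h₁ | h₁ <;> rcases h₂ with h₂ | h₂
  · exfalso
    obtain ⟨x, hx⟩ := hne
    by_cases hxX : x ∈ X
    · exact Set.eq_empty_iff_forall_notMem.1 h₁ x ⟨hx, hxX⟩
    · exact Set.eq_empty_iff_forall_notMem.1 h₂ x ⟨hx, hxX⟩
  · exact absurd ⟨hSab.2 (h₂ hb), ha⟩ (Set.eq_empty_iff_forall_notMem.1 h₁ a)
  · exact absurd ⟨hSab.1 (h₁ ha), hb⟩ (Set.eq_empty_iff_forall_notMem.1 h₂ b)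
  · exact Set.union_subset h₁ h₂

end IsContraction

end Contraction

end SimpleGraph

namespace IsStarProductWitness

variable {V V1 V2 : Type*} {G : SimpleGraph V} {G1 : SimpleGraph V1} {v1 : V1}
  {G2 : SimpleGraph V2} {v2 : V2} {f : V1 → V} {g : V2 → V} {m : V1 → V2}

theorem map_ne (hw : IsStarProductWitness G G1 v1 G2 v2 f g m) {x : V1} (hx : G1.Adj v1 x) :
    m x ≠ v2 := by
  obtain ⟨-, -, -, -, -, -, hm, -⟩ := hw
  exact (show G2.Adj v2 (m x) from hm.mapsTo hx).ne'

theorem compl_image (hw : IsStarProductWitness G G1 v1 G2 v2 f g m) :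
    (f '' {x | x ≠ v1})ᶜ = g '' {y | y ≠ v2} := by
  obtain ⟨-, -, -, -, hfg, hcov, -, -⟩ := hw
  ext v
  constructor
  · intro hv
    exact (hcov v).resolve_left hv
  · rintro ⟨y, hy, rfl⟩ ⟨x, hx, hxy⟩
    exact hfg x y hx hy hxy

theorem symm (hw : IsStarProductWitness G G1 v1 G2 v2 f g m) :
    ∃ m', IsStarProductWitness G G2 v2 G1 v1 g f m' := by
  have : Nonempty V1 := ⟨v1⟩
  obtain ⟨h1, h2, hf, hg, hfg, hcov, hm, hadj⟩ := hw
  have hinv := hm.invOn_invFunOn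
  set m' := Function.invFunOn m (G1.neighborSet v1)
  have hm' : Set.BijOn m' (G2.neighborSet v2) (G1.neighborSet v1) := hm.symm hinv.symm
  refine ⟨m', h2, h1, hg, hf, fun x y hx hy h => hfg y x hy hx h.symm, fun v => (hcov v).symm,
    hm', fun a b => ?_⟩
  rw [hadj]
  have hcut : (∃ x, G1.Adj v1 x ∧ ((a = f x ∧ b = g (m x)) ∨ (b = f x ∧ a = g (m x)))) ↔
      ∃ y, G2.Adj v2 y ∧ ((a = g y ∧ b = f (m' y)) ∨ (b = g y ∧ a = f (m' y))) := by
    constructor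
    · rintro ⟨x, hx, h⟩
      refine ⟨m x, hm.mapsTo hx, ?_⟩
      rw [hinv.1 hx]
      exact h.symm.imp And.symm And.symm
    · rintro ⟨y, hy, h⟩
      refine ⟨m' y, hm'.mapsTo hy, ?_⟩
      rw [hinv.2 hy]
      exact h.symm.imp And.symm And.symm
  rw [hcut]
  exact or_left_comm

theorem adj_image_iff (hw : IsStarProductWitness G G1 v1 G2 v2 f g m) {x y : V1} (hx : x ≠ v1)
    (hy : y ≠ v1) : G.Adj (f x) (f y) ↔ G1.Adj x y := by
  obtain ⟨-, -, hf, -, hfg, -, hm, hadj⟩ := id hw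
  rw [hadj]
  constructor
  · rintro (⟨x', y', hx', hy', h, hxx, hyy⟩ | ⟨x', y', hx', hy', h, hxx, hyy⟩ |
      ⟨z, hz, ⟨-, h⟩ | ⟨-, h⟩⟩)
    · rwa [hf hx hx' hxx, hf hy hy' hyy]
    · exact absurd hxx (hfg _ _ hx hx')
    · exact absurd h (hfg _ _ hy (hw.map_ne hz))
    · exact absurd h (hfg _ _ hx (hw.map_ne hz))
  · exact fun h => Or.inl ⟨x, y, hx, hy, h, rfl, rfl⟩

theorem adj_notMem_iff (hw : IsStarProductWitness G G1 v1 G2 v2 f g m) {x : V1} (hx : x ≠ v1)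
    {b : V} (hb : b ∉ f '' {x | x ≠ v1}) : G.Adj (f x) b ↔ G1.Adj v1 x ∧ b = g (m x) := by
  obtain ⟨-, -, hf, -, hfg, -, hm, hadj⟩ := id hw
  rw [hadj]
  constructor
  · rintro (⟨x', y', hx', hy', h, hxx, rfl⟩ | ⟨x', y', hx', hy', h, hxx, hyy⟩ |
      ⟨z, hz, ⟨h, rfl⟩ | ⟨-, h⟩⟩)
    · exact absurd ⟨y', hy', rfl⟩ hb
    · exact absurd hxx (hfg _ _ hx hx')
    · obtain rfl := hf hx hz.ne' h
      exact ⟨hz, rfl⟩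
    · exact absurd h (hfg _ _ hx (hw.map_ne hz))
  · rintro ⟨h, rfl⟩
    exact Or.inr (Or.inr ⟨x, h, Or.inl ⟨rfl, rfl⟩⟩)

theorem map_notMem (hw : IsStarProductWitness G G1 v1 G2 v2 f g m) {x : V1} (hx : G1.Adj v1 x) :
    g (m x) ∉ f '' {x | x ≠ v1} := by
  rw [← Set.mem_compl_iff, hw.compl_image]
  exact ⟨m x, hw.map_ne hx, rfl⟩

theorem exists_isContraction (hw : IsStarProductWitness G G1 v1 G2 v2 f g m) :
    ∃ c, G.IsContraction G1 v1 (f '' {x | x ≠ v1}) c := by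
  classical
  have : Nonempty V1 := ⟨v1⟩
  obtain ⟨h1, -, hf, -, -, -, -, -⟩ := id hw
  set X := f '' {x | x ≠ v1}
  let c : V → V1 := fun v => if v ∈ X then Function.invFunOn f {x | x ≠ v1} v else v1
  have hcf : ∀ x, x ≠ v1 → c (f x) = x := fun x hx => by
    have hX : f x ∈ X := ⟨x, hx, rfl⟩
    simp only [c, hX, if_true]
    exact hf.leftInvOn_invFunOn hx
  have hcX : ∀ v, v ∉ X → c v = v1 := fun v hv => if_neg hv
  refine ⟨c, ⟨fun a => ⟨?_, fun h => not_not.1 fun ha => h (hcX a ha)⟩, ?_, fun x => ?_, ?_, ?_, ?_⟩⟩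
  · rintro ⟨x, hx, rfl⟩
    rwa [hcf x hx]
  · rintro _ ⟨x, hx, rfl⟩ _ ⟨y, hy, rfl⟩ h
    rw [hcf x hx, hcf y hy] at h
    rw [h]
  · by_cases hx : x = v1
    · obtain ⟨y, hy⟩ : (G1.neighborSet v1).Nonempty := Set.nonempty_of_ncard_ne_zero (by omega)
      exact ⟨g (m y), hx ▸ hcX _ (hw.map_notMem hy)⟩
    · exact ⟨f x, hcf x hx⟩
  · intro a b hab hne
    by_cases ha : a ∈ X <;> by_cases hb : b ∈ X
    · obtain ⟨x, hx, rfl⟩ := ha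
      obtain ⟨y, hy, rfl⟩ := hb
      rw [hcf x hx, hcf y hy]
      exact (hw.adj_image_iff hx hy).1 hab
    · obtain ⟨x, hx, rfl⟩ := ha
      rw [hcf x hx, hcX b hb]
      exact ((hw.adj_notMem_iff hx hb).1 hab).1.symm
    · obtain ⟨y, hy, rfl⟩ := hb
      rw [hcf y hy, hcX a ha]
      exact ((hw.adj_notMem_iff hy ha).1 hab.symm).1
    · exact absurd ((hcX a ha).trans (hcX b hb).symm) hne
  · intro x y hxy
    by_cases hx : x = v1
    · subst hx
      exact ⟨g (m y), f y, hcX _ (hw.map_notMem hxy), hcf y hxy.ne',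
        ((hw.adj_notMem_iff hxy.ne' (hw.map_notMem hxy)).2 ⟨hxy, rfl⟩).symm⟩
    · by_cases hy : y = v1
      · subst hy
        exact ⟨f x, g (m x), hcf x hx, hcX _ (hw.map_notMem hxy.symm),
          (hw.adj_notMem_iff hx (hw.map_notMem hxy.symm)).2 ⟨hxy.symm, rfl⟩⟩
      · exact ⟨f x, f y, hcf x hx, hcf y hy, (hw.adj_image_iff hx hy).2 hxy⟩
  · rintro _ b b' ⟨x, hx, rfl⟩ hb hb' hab hab'
    rw [((hw.adj_notMem_iff hx hb).1 hab).2, ((hw.adj_notMem_iff hx hb').1 hab').2]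

theorem ncard_principalCut_inter (hw : IsStarProductWitness G G1 v1 G2 v2 f g m)
    (M : G.Subgraph) : (principalCut G1 v1 f g m ∩ M.edgeSet).ncard =
      (M.spanningCoe.cutDarts (f '' {x | x ≠ v1})).ncard := by
  rw [← (injOn_sym2_mk_cutDarts _).ncard_image]
  congr 1
  ext e
  constructor
  · rintro ⟨⟨x, hx, rfl⟩, he⟩
    exact ⟨(f x, g (m x)), ⟨he, ⟨x, hx.ne', rfl⟩, hw.map_notMem hx⟩, rfl⟩
  · rintro ⟨⟨_, b⟩, ⟨hab, ⟨x, hx, rfl⟩, hb⟩, rfl⟩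
    obtain ⟨hxadj, rfl⟩ := (hw.adj_notMem_iff hx hb).1 (M.adj_sub hab)
    exact ⟨⟨x, hxadj, rfl⟩, hab⟩

theorem quasiTight_iff (hw : IsStarProductWitness G G1 v1 G2 v2 f g m) :
    (∀ M : G.Subgraph, M.IsPerfectMatching →
      (principalCut G1 v1 f g m ∩ M.edgeSet).ncard = 1) ↔
    ∀ M ≤ G, (∀ v, (M.neighborSet v).ncard = 1) →
      (M.cutDarts (f '' {x | x ≠ v1})).ncard = 1 := by
  constructor
  · intro h M hM hM1
    have := h (toSubgraph M hM) (Subgraph.isPerfectMatching_iff_ncard.2 hM1)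
    rwa [hw.ncard_principalCut_inter] at this
  · intro h M hM
    rw [hw.ncard_principalCut_inter]
    exact h _ M.spanningCoe_le (Subgraph.isPerfectMatching_iff_ncard.1 hM)

end IsStarProductWitness

/-- Let `G = (G1,v1)*(G2,v2)` be a cubic, bridgeless graph. Then `G` is
2-factor Hamiltonian if and only if both `G1` and `G2` are 2-factor Hamiltonian and the
principal 3-edge cut of `G` is quasi-tight (i.e. every perfect matching of `G` contains
exactly one of its edges). -/
theorem starProduct_twoFactorHamiltonian_iff_quasiTight {V V1 V2 : Type*}
    [Fintype V] [Fintype V1] [Fintype V2]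
    (G : SimpleGraph V) (G1 : SimpleGraph V1) (v1 : V1) (G2 : SimpleGraph V2) (v2 : V2)
    (f : V1 → V) (g : V2 → V) (m : V1 → V2)
    (hw : IsStarProductWitness G G1 v1 G2 v2 f g m)
    (hGc : IsCubic G) (hGbl : Bridgeless G) :
    IsTwoFactorHamiltonian G ↔
      (IsTwoFactorHamiltonian G1 ∧ IsTwoFactorHamiltonian G2 ∧
        ∀ M : G.Subgraph, M.IsPerfectMatching →
          (principalCut G1 v1 f g m ∩ M.edgeSet).ncard = 1) := by
  obtain ⟨m', hw'⟩ := hw.symm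
  obtain ⟨c, hc⟩ := hw.exists_isContraction
  obtain ⟨c', hc'⟩ := hw'.exists_isContraction
  have hb : ∀ e ∈ G.edgeSet, ¬ G.IsBridge e := fun e _ => hGbl e
  have h1 : (G1.neighborSet v1).ncard = 3 := hw.1
  have h2 : (G2.neighborSet v2).ncard = 3 := hw'.1
  rw [isTwoFactorHamiltonian_iff, isTwoFactorHamiltonian_iff, isTwoFactorHamiltonian_iff,
    hw.quasiTight_iff]
  constructor
  · intro h
    exact ⟨fun H hH => hc.connected_of_isTwoFactorHamiltonian hGc hb h1 h hH,
      fun H hH => hc'.connected_of_isTwoFactorHamiltonian hGc hb h2 h hH,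
      fun M hM => hc.ncard_cutDarts_eq_one hGc h1 h hM⟩
  · rintro ⟨hG1, hG2, hM⟩ H hH
    rw [← hw.compl_image] at hc'
    exact hc.connected_of_contractions hc' hGc h1 hG1 hG2 hM hH
end
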